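/- arXiv:math/0206263 — 2 statements merged into one kernel-verified Lean document; each statement's English description precedes it below -/
import Mathlib

section
/- Let n ∈ {0,…,m−1}, k ∈ ℤ, and let (k_0,…,k_ℓ) be nonnegative integers with k_0 + ⋯ + k_ℓ = m. Then the number of words w of length m with content (k_0,…,k_ℓ) such that (w,k) ∈ Ô_n equals (1/m)·Σ_{d ∣ gcd(k_0,…,k_ℓ)} φ_{k−n}(d)·(m/d)!/((k_0/d)!⋯(k_ℓ/d)!). -/
open Finset Polynomial

namespace GreensteinPaths

noncomputable section

attribute [local instance] Classical.propDecidable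

variable {ℓ m : ℕ}

/-- The Kashiwara function `R^i_p(w)` (positions are 0-based: index `p` is
the mathematical position `p+1`, i.e. the `(p+1)`-th tensor factor counted
from the right). -/
def Rf (i : ZMod (ℓ + 1)) (w : Fin m → ZMod (ℓ + 1)) (p : Fin m) : ℤ :=
    (if i = w p then 1 else 0)
  + ∑ s ∈ univ.filter (fun s : Fin m => p < s),
      ((if i = w s then 1 else 0) - (if i = w s + 1 then 1 else 0))

/-- `ε_i(w) = max_p R^i_p(w)` (the maximum is nonnegative for `m ≥ 1`,
so we may record it as a natural number). -/
def eps (i : ZMod (ℓ + 1)) (w : Fin m → ZMod (ℓ + 1)) : ℕ :=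
  univ.sup fun p => (Rf i w p).toNat

/-- `φ_i(w) = ε_i(w) + Σ_s (δ_{i,w_s+1} − δ_{i,w_s})`. -/
def phiW (i : ZMod (ℓ + 1)) (w : Fin m → ZMod (ℓ + 1)) : ℤ :=
  (eps i w : ℤ)
    + ∑ s : Fin m, ((if i = w s + 1 then 1 else 0) - (if i = w s then 1 else 0))

/-- The Kashiwara operator `e_i`, as a partial map: take the largest `p`
with `R^i_p(w) = ε_i(w)`; if `w_p = i`, replace it by `i - 1`, otherwise
the result is undefined. -/
def eOp (i : ZMod (ℓ + 1)) (w : Fin m → ZMod (ℓ + 1)) :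
    Option (Fin m → ZMod (ℓ + 1)) :=
  WithBot.recBotCoe none
    (fun p => if w p = i then some (Function.update w p (i - 1)) else none)
    ((univ.filter fun p => Rf i w p = (eps i w : ℤ)).max)

/-- The Kashiwara operator `f_i`, as a partial map: take the smallest `p`
with `R^i_p(w) = ε_i(w)`; if `w_p = i - 1`, replace it by `i`, otherwise
the result is undefined. -/
def fOp (i : ZMod (ℓ + 1)) (w : Fin m → ZMod (ℓ + 1)) :
    Option (Fin m → ZMod (ℓ + 1)) :=
  WithTop.recTopCoe none
    (fun p => if w p = i - 1 then some (Function.update w p i) else none)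
    ((univ.filter fun p => Rf i w p = (eps i w : ℤ)).min)

/-- The descent set of a word, 0-based: `r ∈ desc w` corresponds to the
mathematical descent `r+1` (i.e. `w_{r+1} > w_{r+2}` in 1-based notation),
letters being compared as integers in `{0,…,ℓ}`. -/
def desc (w : Fin m → ZMod (ℓ + 1)) : Finset (Fin m) :=
  univ.filter fun r : Fin m =>
    ∃ h : (r : ℕ) + 1 < m, (w ⟨(r : ℕ) + 1, h⟩).val < (w r).val

/-- `N(w) = Σ_{r=1}^{k} r (n_r − n_{r−1})` where `0 = n_0 < n_1 < ⋯ < n_{k−1} < n_k = m`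
and `n_1 < ⋯ < n_{k−1}` are the descents: equivalently the mathematical
position `p` (`1 ≤ p ≤ m`) contributes `1` plus the number of descents
strictly below `p`. -/
def Nfun (w : Fin m → ZMod (ℓ + 1)) : ℕ :=
  ∑ p : Fin m, (1 + ((desc w).filter fun r => r < p).card)

/-- The major index: the sum of the descents (which are `r+1` for the
0-based `r ∈ desc w`). -/
def MajFun (w : Fin m → ZMod (ℓ + 1)) : ℕ :=
  ∑ r ∈ desc w, ((r : ℕ) + 1)

/-- Content of a word: `content w j` is the number of positions carrying the letter `j`. -/
def content (w : Fin m → ZMod (ℓ + 1)) (j : ZMod (ℓ + 1)) : ℕ :=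
  (univ.filter fun p => w p = j).card

/-- The affine operator `ê_i` on pairs `(w, c)`. -/
def eHat (i : ZMod (ℓ + 1)) (x : (Fin m → ZMod (ℓ + 1)) × ℤ) :
    Option ((Fin m → ZMod (ℓ + 1)) × ℤ) :=
  (eOp i x.1).map fun w' => (w', x.2 + if i = 0 then 1 else 0)

/-- The affine operator `f̂_i` on pairs `(w, c)`. -/
def fHat (i : ZMod (ℓ + 1)) (x : (Fin m → ZMod (ℓ + 1)) × ℤ) :
    Option ((Fin m → ZMod (ℓ + 1)) × ℤ) :=
  (fOp i x.1).map fun w' => (w', x.2 - if i = 0 then 1 else 0)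

/-- One application of some `ê_i` or `f̂_i`. -/
def hatStep (x y : (Fin m → ZMod (ℓ + 1)) × ℤ) : Prop :=
  ∃ i, eHat i x = some y ∨ fHat i x = some y

/-- `Ô_n`: all pairs obtainable from `((0,…,0), n)` by finitely many
applications of the operators `ê_i`, `f̂_i`. -/
def Ohat (n : ℤ) : Set ((Fin m → ZMod (ℓ + 1)) × ℤ) :=
  {x | Relation.ReflTransGen hatStep ((fun _ => 0), n) x}

/-- Successive application of a partial operator along a list of indices
(the head of the list is applied first); the result is defined only if
every intermediate application is defined. -/
def applyList
    (op : ZMod (ℓ + 1) → (Fin m → ZMod (ℓ + 1)) → Option (Fin m → ZMod (ℓ + 1))) :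
    List (ZMod (ℓ + 1)) → (Fin m → ZMod (ℓ + 1)) → Option (Fin m → ZMod (ℓ + 1))
  | [], w => some w
  | i :: is, w => (op i w).bind (applyList op is)

/-- `n`-fold application of `e_i`. -/
def eIter (i : ZMod (ℓ + 1)) : ℕ → (Fin m → ZMod (ℓ + 1)) → Option (Fin m → ZMod (ℓ + 1))
  | 0, w => some w
  | n + 1, w => (eOp i w).bind (eIter i n)

/-- `φ_n(d) = φ(d)·μ(d/g)/φ(d/g)`, `g = gcd(d,|n|)`. -/
def phiInt (n : ℤ) (d : ℕ) : ℚ :=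
  (Nat.totient d : ℚ) * (ArithmeticFunction.moebius (d / Nat.gcd d n.natAbs) : ℚ)
    / (Nat.totient (d / Nat.gcd d n.natAbs) : ℚ)

/-- The multinomial coefficient `(m/d)! / ((k_0/d)! ⋯ (k_ℓ/d)!)`, with the
convention that it is `0` unless all its entries are (nonnegative) integers. -/
def multinomialQ {ι : Type} [Fintype ι] (M : ℕ) (k : ι → ℕ) (d : ℕ) : ℚ :=
  if d ∣ M ∧ ∀ j, d ∣ k j then
    ((M / d).factorial : ℚ) / ∏ j, ((k j / d).factorial : ℚ)
  else 0

/-- `C(k_0,…,k_ℓ; n) = (1/m) Σ_{d ∣ m} φ_n(d) · multinomial(m/d; k_j/d)`. -/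
def Cfun {ι : Type} [Fintype ι] (M : ℕ) (k : ι → ℕ) (n : ℤ) : ℚ :=
  (1 / (M : ℚ)) * ∑ d ∈ M.divisors, phiInt n d * multinomialQ M k d

/-- `C̃(k_0,…,k_ℓ; d) = (d/m) Σ_{d d' ∣ m} μ(d') · multinomial(m/(dd'); k_j/(dd'))`. -/
def Ctil {ι : Type} [Fintype ι] (M : ℕ) (k : ι → ℕ) (d : ℕ) : ℚ :=
  ((d : ℚ) / (M : ℚ)) *
    ∑ d' ∈ M.divisors.filter (fun d' => d * d' ∣ M),
      (ArithmeticFunction.moebius d' : ℚ) * multinomialQ M k (d * d')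

/-- `[n]_q = 1 + q + ⋯ + q^{n−1}` in `ℤ[q]`. -/
def qNat (n : ℕ) : Polynomial ℤ := ∑ i ∈ Finset.range n, X ^ i

/-- `[n]_q! = [n]_q [n−1]_q ⋯ [1]_q`. -/
def qFactorial (n : ℕ) : Polynomial ℤ := ∏ i ∈ Finset.range n, qNat (i + 1)

/-- The Gaussian multinomial `[n; k_1,…,k_r]_q = [n]_q!/([k_1]_q! ⋯ [k_r]_q!)`
(an exact division of polynomials, performed here as division by a monic
polynomial), with the convention that it is `0` if `n ≠ k_1 + ⋯ + k_r`. -/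
def qMultinomial {ι : Type} [Fintype ι] (n : ℕ) (k : ι → ℕ) : Polynomial ℤ :=
  if ∑ j, k j = n then qFactorial n /ₘ ∏ j, qFactorial (k j) else 0

end

section CrystalOperators

attribute [local instance] Classical.propDecidable

variable {ℓ m : ℕ}

lemma sub_one_ne_self (hℓ : 1 ≤ ℓ) (i : ZMod (ℓ + 1)) : i - 1 ≠ i := by
  have : Fact (1 < ℓ + 1) := ⟨by omega⟩
  simp

/-- The difference of two values of `R^i`. -/
lemma Rf_eq_add_sum (i : ZMod (ℓ + 1)) (w : Fin m → ZMod (ℓ + 1)) {p q : Fin m} (h : q < p) :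
    Rf i w q = Rf i w p - (if i = w p then 1 else 0) + (if i = w q then 1 else 0)
      + ∑ s ∈ univ.filter (fun s : Fin m => q < s ∧ s ≤ p),
          ((if i = w s then 1 else 0) - (if i = w s + 1 then 1 else 0)) := by
  have hset : univ.filter (fun s : Fin m => q < s) =
      univ.filter (fun s : Fin m => q < s ∧ s ≤ p) ∪ univ.filter (fun s : Fin m => p < s) := by
    ext s
    simp only [mem_filter, mem_univ, true_and, mem_union]
    omega
  have hdisj : Disjoint (univ.filter (fun s : Fin m => q < s ∧ s ≤ p))
      (univ.filter (fun s : Fin m => p < s)) := by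
    rw [Finset.disjoint_left]
    intro s
    simp only [mem_filter, mem_univ, true_and]
    omega
  unfold Rf
  rw [hset, sum_union hdisj]
  ring

lemma Rf_of_succ (i : ZMod (ℓ + 1)) (w : Fin m → ZMod (ℓ + 1)) {p q : Fin m}
    (h : (q : ℕ) + 1 = p) :
    Rf i w q = Rf i w p + (if i = w q then 1 else 0) - (if i = w p + 1 then 1 else 0) := by
  have hset : univ.filter (fun s : Fin m => q < s ∧ s ≤ p) = {p} := by
    ext s
    simp only [mem_filter, mem_univ, true_and, mem_singleton]
    omega
  rw [Rf_eq_add_sum i w (show q < p by omega), hset, sum_singleton]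
  ring

/-- Position `p` is the largest one maximizing `R^i`. -/
def IsLastMax (i : ZMod (ℓ + 1)) (w : Fin m → ZMod (ℓ + 1)) (p : Fin m) : Prop :=
  (∀ q, Rf i w q ≤ Rf i w p) ∧ ∀ q, p < q → Rf i w q < Rf i w p

/-- Position `p` is the smallest one maximizing `R^i`. -/
def IsFirstMax (i : ZMod (ℓ + 1)) (w : Fin m → ZMod (ℓ + 1)) (p : Fin m) : Prop :=
  (∀ q, Rf i w q ≤ Rf i w p) ∧ ∀ q, q < p → Rf i w q < Rf i w p

lemma exists_Rf_nonneg (i : ZMod (ℓ + 1)) (w : Fin m → ZMod (ℓ + 1)) (hm : 0 < m) :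
    ∃ q, 0 ≤ Rf i w q := by
  refine ⟨⟨m - 1, by omega⟩, ?_⟩
  unfold Rf
  rw [Finset.filter_false_of_mem]
  · simp only [sum_empty, add_zero]
    split_ifs <;> simp
  · intro s _ h
    have := s.2
    simp only [Fin.lt_def] at h
    omega

lemma Rf_le_eps (i : ZMod (ℓ + 1)) (w : Fin m → ZMod (ℓ + 1)) (q : Fin m) :
    Rf i w q ≤ eps i w :=
  (Int.self_le_toNat _).trans
    (by exact_mod_cast Finset.le_sup (f := fun p => (Rf i w p).toNat) (mem_univ q))

lemma eps_eq_of_forall_le (i : ZMod (ℓ + 1)) (w : Fin m → ZMod (ℓ + 1)) (p : Fin m)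
    (h : ∀ q, Rf i w q ≤ Rf i w p) : (eps i w : ℤ) = Rf i w p := by
  refine le_antisymm ?_ (Rf_le_eps i w p)
  obtain ⟨q, hq⟩ := exists_Rf_nonneg i w p.pos
  have h0 : 0 ≤ Rf i w p := hq.trans (h q)
  have : eps i w ≤ (Rf i w p).toNat :=
    Finset.sup_le fun q _ => Int.toNat_le_toNat (h q)
  omega

lemma isLastMax_of_max_eq (i : ZMod (ℓ + 1)) (w : Fin m → ZMod (ℓ + 1)) (p : Fin m)
    (h : (univ.filter fun p => Rf i w p = (eps i w : ℤ)).max = p) : IsLastMax i w p := by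
  have hp := Finset.mem_of_max h
  simp only [mem_filter, mem_univ, true_and] at hp
  have hle : ∀ q, Rf i w q ≤ Rf i w p := fun q => hp ▸ Rf_le_eps i w q
  refine ⟨hle, fun q hq => lt_of_le_of_ne (hle q) fun he => ?_⟩
  have := Finset.le_max_of_eq (s := univ.filter fun p => Rf i w p = (eps i w : ℤ))
    (a := q) (by simp [he, hp]) h
  exact absurd hq (not_lt.2 this)

lemma isFirstMax_of_min_eq (i : ZMod (ℓ + 1)) (w : Fin m → ZMod (ℓ + 1)) (p : Fin m)
    (h : (univ.filter fun p => Rf i w p = (eps i w : ℤ)).min = p) : IsFirstMax i w p := by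
  have hp := Finset.mem_of_min h
  simp only [mem_filter, mem_univ, true_and] at hp
  have hle : ∀ q, Rf i w q ≤ Rf i w p := fun q => hp ▸ Rf_le_eps i w q
  refine ⟨hle, fun q hq => lt_of_le_of_ne (hle q) fun he => ?_⟩
  have := Finset.min_le_of_eq (s := univ.filter fun p => Rf i w p = (eps i w : ℤ))
    (b := q) (by simp [he, hp]) h
  exact absurd hq (not_lt.2 this)

lemma IsLastMax.max_eq {i : ZMod (ℓ + 1)} {w : Fin m → ZMod (ℓ + 1)} {p : Fin m}
    (h : IsLastMax i w p) : (univ.filter fun p => Rf i w p = (eps i w : ℤ)).max = p := by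
  have he := eps_eq_of_forall_le i w p h.1
  refine le_antisymm (Finset.max_le fun q hq => ?_) (Finset.le_max (by simp [he]))
  simp only [mem_filter, mem_univ, true_and] at hq
  by_contra hlt
  have := h.2 q (by simpa using hlt)
  omega

lemma IsFirstMax.min_eq {i : ZMod (ℓ + 1)} {w : Fin m → ZMod (ℓ + 1)} {p : Fin m}
    (h : IsFirstMax i w p) : (univ.filter fun p => Rf i w p = (eps i w : ℤ)).min = p := by
  have he := eps_eq_of_forall_le i w p h.1
  refine le_antisymm (Finset.min_le (by simp [he])) (Finset.le_min fun q hq => ?_)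
  simp only [mem_filter, mem_univ, true_and] at hq
  by_contra hlt
  have := h.2 q (by simpa using hlt)
  omega

lemma eOp_eq_some_iff {i : ZMod (ℓ + 1)} {w w' : Fin m → ZMod (ℓ + 1)} :
    eOp i w = some w' ↔
      ∃ p, IsLastMax i w p ∧ w p = i ∧ w' = Function.update w p (i - 1) := by
  constructor
  · intro h
    unfold eOp at h
    cases hx : (univ.filter fun p => Rf i w p = (eps i w : ℤ)).max with
    | bot => rw [hx] at h; simp at h
    | coe p =>
      rw [hx] at h
      simp only [WithBot.recBotCoe_coe, Option.ite_none_right_eq_some, Option.some.injEq] at h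
      exact ⟨p, isLastMax_of_max_eq i w p hx, h.1, h.2.symm⟩
  · rintro ⟨p, hp, hi, rfl⟩
    unfold eOp
    rw [hp.max_eq]
    simp [hi]

lemma fOp_eq_some_iff {i : ZMod (ℓ + 1)} {w w' : Fin m → ZMod (ℓ + 1)} :
    fOp i w = some w' ↔
      ∃ p, IsFirstMax i w p ∧ w p = i - 1 ∧ w' = Function.update w p i := by
  constructor
  · intro h
    unfold fOp at h
    cases hx : (univ.filter fun p => Rf i w p = (eps i w : ℤ)).min with
    | top => rw [hx] at h; simp at h
    | coe p =>
      rw [hx] at h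
      simp only [WithTop.recTopCoe_coe, Option.ite_none_right_eq_some, Option.some.injEq] at h
      exact ⟨p, isFirstMax_of_min_eq i w p hx, h.1, h.2.symm⟩
  · rintro ⟨p, hp, hi, rfl⟩
    unfold fOp
    rw [hp.min_eq]
    simp [hi]

/-- The effect on `R^i` of replacing a letter `i` by `i - 1`. -/
lemma Rf_update (hℓ : 1 ≤ ℓ) {i : ZMod (ℓ + 1)} {w : Fin m → ZMod (ℓ + 1)} {p : Fin m}
    (hi : w p = i) (q : Fin m) :
    Rf i (Function.update w p (i - 1)) q =
      Rf i w q - (if q = p then 1 else 0) - (if q < p then 2 else 0) := by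
  have hne := sub_one_ne_self hℓ i
  have hne' : i ≠ i + 1 := fun h => by
    have := sub_one_ne_self hℓ (i + 1)
    rw [add_sub_cancel_right] at this
    exact this h
  have hterm : ∀ s : Fin m,
      ((if i = Function.update w p (i - 1) s then 1 else 0 : ℤ)
        - (if i = Function.update w p (i - 1) s + 1 then 1 else 0)) =
      ((if i = w s then 1 else 0) - (if i = w s + 1 then 1 else 0))
        - (if s = p then 2 else 0) := by
    intro s
    by_cases hs : s = p
    · subst hs
      simp [hi, hne.symm, hne']
    · simp [hs]
  have hfirst : (if i = Function.update w p (i - 1) q then 1 else 0 : ℤ) =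
      (if i = w q then 1 else 0) - (if q = p then 1 else 0) := by
    by_cases hs : q = p
    · subst hs
      simp [hi, hne.symm]
    · simp [hs]
  unfold Rf
  rw [hfirst, Finset.sum_congr rfl fun s _ => hterm s, Finset.sum_sub_distrib,
    Finset.sum_ite_eq']
  simp only [mem_filter, mem_univ, true_and]
  ring

/-- The operator `f_i` undoes `e_i`. -/
lemma fOp_of_eOp (hℓ : 1 ≤ ℓ) {i : ZMod (ℓ + 1)} {w w' : Fin m → ZMod (ℓ + 1)}
    (h : eOp i w = some w') : fOp i w' = some w := by
  obtain ⟨p, hp, hi, rfl⟩ := eOp_eq_some_iff.1 h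
  refine fOp_eq_some_iff.2 ⟨p, ⟨fun q => ?_, fun q hq => ?_⟩, by simp, by simp [← hi]⟩
  · rw [Rf_update hℓ hi, Rf_update hℓ hi]
    rcases lt_trichotomy q p with hq | rfl | hq
    · have := hp.1 q
      simp [hq, hq.ne]
      omega
    · simp
    · have := hp.2 q hq
      simp [hq.ne', hq.not_gt]
      omega
  · rw [Rf_update hℓ hi, Rf_update hℓ hi]
    have := hp.1 q
    simp [hq, hq.ne]
    omega

end CrystalOperators

section Reachability

attribute [local instance] Classical.propDecidable

variable {ℓ m : ℕ}

/-- One application of some `ê_i`. -/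
def eHatStep (x y : (Fin m → ZMod (ℓ + 1)) × ℤ) : Prop :=
  ∃ i, eHat i x = some y

lemma eHat_eq_some_iff {i : ZMod (ℓ + 1)} {x y : (Fin m → ZMod (ℓ + 1)) × ℤ} :
    eHat i x = some y ↔ eOp i x.1 = some y.1 ∧ y.2 = x.2 + if i = 0 then 1 else 0 := by
  rw [eHat, Option.map_eq_some_iff]
  constructor
  · rintro ⟨w, hw, rfl⟩
    exact ⟨hw, rfl⟩
  · rintro ⟨h1, h2⟩
    exact ⟨y.1, h1, by rw [← h2]⟩

lemma fHat_eq_some_iff {i : ZMod (ℓ + 1)} {x y : (Fin m → ZMod (ℓ + 1)) × ℤ} :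
    fHat i x = some y ↔ fOp i x.1 = some y.1 ∧ y.2 = x.2 - if i = 0 then 1 else 0 := by
  rw [fHat, Option.map_eq_some_iff]
  constructor
  · rintro ⟨w, hw, rfl⟩
    exact ⟨hw, rfl⟩
  · rintro ⟨h1, h2⟩
    exact ⟨y.1, h1, by rw [← h2]⟩

lemma eHatStep_of_eOp {i : ZMod (ℓ + 1)} {w w' : Fin m → ZMod (ℓ + 1)} (c : ℤ)
    (h : eOp i w = some w') : eHatStep (w, c) (w', c + if i = 0 then 1 else 0) :=
  ⟨i, eHat_eq_some_iff.2 ⟨h, rfl⟩⟩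

lemma hatStep_of_eHatStep {x y : (Fin m → ZMod (ℓ + 1)) × ℤ} (h : eHatStep x y) :
    hatStep x y :=
  h.imp fun _ hi => Or.inl hi

lemma hatStep_symm_of_eHatStep (hℓ : 1 ≤ ℓ) {x y : (Fin m → ZMod (ℓ + 1)) × ℤ}
    (h : eHatStep x y) : hatStep y x := by
  obtain ⟨i, hi⟩ := h
  obtain ⟨h1, h2⟩ := eHat_eq_some_iff.1 hi
  exact ⟨i, Or.inr (fHat_eq_some_iff.2 ⟨fOp_of_eOp hℓ h1, by rw [h2]; ring⟩)⟩

lemma hatReach_of_eHatReach {x y : (Fin m → ZMod (ℓ + 1)) × ℤ}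
    (h : Relation.ReflTransGen eHatStep x y) : Relation.ReflTransGen hatStep x y :=
  Relation.ReflTransGen.mono (fun _ _ => hatStep_of_eHatStep) _ _ h

lemma hatReach_symm_of_eHatReach (hℓ : 1 ≤ ℓ) {x y : (Fin m → ZMod (ℓ + 1)) × ℤ}
    (h : Relation.ReflTransGen eHatStep x y) : Relation.ReflTransGen hatStep y x := by
  induction h with
  | refl => exact .refl
  | tail _ hbc ih => exact .head (hatStep_symm_of_eHatStep hℓ hbc) ih

/-- If the letters `i` form a final segment of `w`, then `e_i` acts on the first of them. -/
lemma eOp_of_final_segment {i : ZMod (ℓ + 1)} {w : Fin m → ZMod (ℓ + 1)} {p : Fin m}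
    (hℓ : 1 ≤ ℓ) (hge : ∀ q, p ≤ q → w q = i) (hlt : ∀ q, q < p → w q ≠ i) :
    eOp i w = some (Function.update w p (i - 1)) := by
  have hne : i ≠ i + 1 := fun h => by
    have := sub_one_ne_self hℓ (i + 1)
    rw [add_sub_cancel_right] at this
    exact this h
  have hgt : ∀ q, p < q → Rf i w q < Rf i w p := by
    intro q hq
    rw [Rf_eq_add_sum i w hq, hge p le_rfl, hge q hq.le]
    have : ∑ s ∈ univ.filter (fun s : Fin m => p < s ∧ s ≤ q),
          ((if i = w s then 1 else 0 : ℤ) - (if i = w s + 1 then 1 else 0)) =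
        ∑ s ∈ univ.filter (fun s : Fin m => p < s ∧ s ≤ q), 1 :=
      Finset.sum_congr rfl fun s hs => by
        simp only [mem_filter, mem_univ, true_and] at hs
        simp [hge s hs.1.le, hne]
    rw [this]
    have hpos : 0 < (univ.filter (fun s : Fin m => p < s ∧ s ≤ q)).card :=
      Finset.card_pos.2 ⟨q, by simp [hq]⟩
    rw [Finset.sum_const, nsmul_eq_mul, mul_one]
    simp only [if_true]
    omega
  refine eOp_eq_some_iff.2 ⟨p, ⟨fun q => ?_, hgt⟩, hge p le_rfl, rfl⟩
  rcases lt_trichotomy q p with hq | rfl | hq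
  · rw [Rf_eq_add_sum i w hq]
    have : ∑ s ∈ univ.filter (fun s : Fin m => q < s ∧ s ≤ p),
          ((if i = w s then 1 else 0 : ℤ) - (if i = w s + 1 then 1 else 0)) ≤
        ∑ s ∈ univ.filter (fun s : Fin m => q < s ∧ s ≤ p), (if s = p then 1 else 0) := by
      refine Finset.sum_le_sum fun s hs => ?_
      simp only [mem_filter, mem_univ, true_and] at hs
      rcases hs.2.eq_or_lt with rfl | hsp
      · simp [hge s le_rfl, hne]
      · simp only [(hlt s hsp).symm, hsp.ne, if_false]
        split_ifs <;> simp
    rw [Finset.sum_ite_eq'] at this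
    simp only [mem_filter, mem_univ, true_and, hq, le_refl, if_true] at this
    simp only [hge p le_rfl, (hlt q hq).symm, if_true, if_false]
    linarith
  · exact le_rfl
  · exact (hgt q hq).le

/-- A final segment consisting of all letters `j` of a word can be lowered to `j - 1`. -/
lemma eHatReach_lower_final_segment (hℓ : 1 ≤ ℓ) (j : ZMod (ℓ + 1)) :
    ∀ (r t : ℕ), t + r = m → ∀ (u : Fin m → ZMod (ℓ + 1)) (c : ℤ),
      (∀ q : Fin m, (q : ℕ) < t → u q ≠ j) →
      Relation.ReflTransGen eHatStep ((fun q => if (q : ℕ) < t then u q else j), c)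
        ((fun q => if (q : ℕ) < t then u q else j - 1), c + r * if j = 0 then 1 else 0) := by
  intro r
  induction r with
  | zero =>
    intro t ht u c _
    have h1 : ∀ x, (fun q : Fin m => if (q : ℕ) < t then u q else x) = u := fun x => by
      ext q
      rw [if_pos (by omega)]
    simp only [h1]
    simpa using Relation.ReflTransGen.refl
  | succ r ih =>
    intro t ht u c hu
    let p : Fin m := ⟨t, by omega⟩
    have hstep := eOp_of_final_segment (i := j) (p := p)
      (w := fun q => if (q : ℕ) < t then u q else j) hℓ
      (fun q hq => if_neg (by simpa [p, Fin.le_def] using hq))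
      (fun q hq => by
        have hq' : (q : ℕ) < t := hq
        simpa [hq'] using hu q hq')
    refine .head (eHatStep_of_eOp c hstep) ?_
    have := ih (t + 1) (by omega) (Function.update u p (j - 1))
      (c + if j = 0 then 1 else 0) (fun q hq => by
        by_cases hqp : q = p
        · subst hqp
          simpa using sub_one_ne_self hℓ j
        · rw [Function.update_of_ne hqp]
          refine hu q ?_
          have : (q : ℕ) ≠ t := fun h => hqp (Fin.ext h)
          omega)
    convert this using 2
    · ext q
      by_cases hqp : q = p
      · subst hqp
        simp [p]
      · have : (q : ℕ) ≠ t := fun h => hqp (Fin.ext h)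
        have h2 : (q : ℕ) < t + 1 ↔ (q : ℕ) < t := by omega
        simp [hqp, h2]
    · ext q
      by_cases hqp : q = p
      · subst hqp
        simp [p]
      · have : (q : ℕ) ≠ t := fun h => hqp (Fin.ext h)
        have h2 : (q : ℕ) < t + 1 ↔ (q : ℕ) < t := by omega
        simp [hqp, h2]
    · push_cast
      ring

lemma eHatReach_const_sub_one (hℓ : 1 ≤ ℓ) (j : ZMod (ℓ + 1)) (c : ℤ) :
    Relation.ReflTransGen eHatStep ((fun _ : Fin m => j), c)
      ((fun _ => j - 1), c + m * if j = 0 then 1 else 0) := by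
  simpa using eHatReach_lower_final_segment (m := m) hℓ j m 0 (by simp) (fun _ => 0) c (by simp)

lemma eHatReach_const_sub (hℓ : 1 ≤ ℓ) (j : ZMod (ℓ + 1)) (c : ℤ) (n : ℕ) :
    ∃ c', Relation.ReflTransGen eHatStep ((fun _ : Fin m => j), c) ((fun _ => j - n), c') := by
  induction n with
  | zero => exact ⟨c, by simpa using Relation.ReflTransGen.refl⟩
  | succ n ih =>
    obtain ⟨c', h⟩ := ih
    have h' := eHatReach_const_sub_one (m := m) hℓ (j - n) c'
    rw [sub_sub, ← Nat.cast_succ] at h'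
    exact ⟨_, h.trans h'⟩

lemma eHatReach_const_zero_add (hℓ : 1 ≤ ℓ) (c : ℤ) :
    Relation.ReflTransGen eHatStep ((fun _ : Fin m => (0 : ZMod (ℓ + 1))), c)
      ((fun _ => 0), c + m) := by
  have key : ∀ n : ℕ, n ≤ ℓ → Relation.ReflTransGen eHatStep
      ((fun _ : Fin m => (0 : ZMod (ℓ + 1))), c) ((fun _ => -((n : ZMod (ℓ + 1)) + 1)), c + m) := by
    intro n
    induction n with
    | zero =>
      intro _
      simpa using eHatReach_const_sub_one (m := m) hℓ (0 : ZMod (ℓ + 1)) c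
    | succ n ih =>
      intro hn
      refine (ih (by omega)).trans ?_
      have h := eHatReach_const_sub_one (m := m) hℓ (-((n : ZMod (ℓ + 1)) + 1)) (c + m)
      have h0 : -((n : ZMod (ℓ + 1)) + 1) ≠ 0 := by
        rw [neg_ne_zero]
        intro h
        have h1 : ((n + 1 : ℕ) : ZMod (ℓ + 1)) = 0 := by exact_mod_cast h
        rw [ZMod.natCast_eq_zero_iff] at h1
        have := Nat.le_of_dvd (by omega) h1
        omega
      rw [if_neg h0, mul_zero, add_zero] at h
      convert h using 3
      push_cast
      ring
  have h := key ℓ le_rfl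
  have h0 : ((ℓ : ZMod (ℓ + 1)) + 1) = 0 := by exact_mod_cast ZMod.natCast_self (ℓ + 1)
  simpa [h0] using h

lemma Rf_cons_succ (i a : ZMod (ℓ + 1)) (v : Fin m → ZMod (ℓ + 1)) (p : Fin m) :
    Rf i (Fin.cons a v : Fin (m + 1) → ZMod (ℓ + 1)) p.succ = Rf i v p := by
  unfold Rf
  rw [Finset.sum_filter, Finset.sum_filter, Fin.sum_univ_succ]
  simp

/-- A step of the tail of a word lifts to a path of the whole word. -/
lemma exists_eHatReach_cons (hℓ : 1 ≤ ℓ) {i : ZMod (ℓ + 1)} {v v' : Fin m → ZMod (ℓ + 1)}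
    (h : eOp i v = some v') (a : ZMod (ℓ + 1)) (c : ℤ) :
    ∃ a' c', Relation.ReflTransGen eHatStep
      ((Fin.cons a v : Fin (m + 1) → ZMod (ℓ + 1)), c) (Fin.cons a' v', c') := by
  obtain ⟨p, hp, hi, rfl⟩ := eOp_eq_some_iff.1 h
  have htail : ∀ b : ZMod (ℓ + 1),
      Rf i (Fin.cons b v : Fin (m + 1) → ZMod (ℓ + 1)) 0 ≤ Rf i v p →
      eOp i (Fin.cons b v : Fin (m + 1) → ZMod (ℓ + 1)) =
        some (Fin.cons b (Function.update v p (i - 1))) := by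
    intro b hb
    refine eOp_eq_some_iff.2 ⟨p.succ, ⟨fun q => ?_, fun q hq => ?_⟩, by simpa using hi, ?_⟩
    · rw [Rf_cons_succ]
      refine Fin.cases hb (fun q => ?_) q
      rw [Rf_cons_succ]
      exact hp.1 q
    · revert hq
      refine Fin.cases (fun hq => absurd hq (by simp)) (fun q hq => ?_) q
      rw [Rf_cons_succ, Rf_cons_succ]
      exact hp.2 q (by simpa using hq)
    · rw [Fin.cons_update]
  by_cases hle : Rf i (Fin.cons a v : Fin (m + 1) → ZMod (ℓ + 1)) 0 ≤ Rf i v p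
  · exact ⟨a, _, .single (eHatStep_of_eOp c (htail a hle))⟩
  have hm := p.pos
  have hsucc : ∀ b : ZMod (ℓ + 1), b ≠ i →
      Rf i (Fin.cons b v : Fin (m + 1) → ZMod (ℓ + 1)) 0 ≤ Rf i v p := by
    intro b hb
    have := Rf_of_succ i (Fin.cons b v : Fin (m + 1) → ZMod (ℓ + 1)) (q := 0)
      (p := Fin.succ ⟨0, hm⟩) (by simp)
    rw [Rf_cons_succ] at this
    have h2 := hp.1 ⟨0, hm⟩
    simp only [Fin.cons_zero, hb.symm, if_false] at this
    split_ifs at this <;> omega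
  have hai : a = i := by_contra fun hne => hle (hsucc a hne)
  have hfirst : eOp i (Fin.cons a v : Fin (m + 1) → ZMod (ℓ + 1)) =
      some (Fin.cons (i - 1) v) := by
    have key : ∀ q : Fin m, Rf i (Fin.cons a v : Fin (m + 1) → ZMod (ℓ + 1)) q.succ <
        Rf i (Fin.cons a v : Fin (m + 1) → ZMod (ℓ + 1)) 0 := fun q => by
      rw [Rf_cons_succ]
      have := hp.1 q
      omega
    refine eOp_eq_some_iff.2 ⟨0, ⟨fun q => ?_, fun q hq => ?_⟩, by simpa using hai, ?_⟩
    · exact Fin.cases le_rfl (fun q => (key q).le) q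
    · revert hq
      exact Fin.cases (fun hq => absurd hq (lt_irrefl _)) (fun q _ => key q) q
    · rw [Fin.update_cons_zero]
  exact ⟨i - 1, _, .head (eHatStep_of_eOp c hfirst)
    (.single (eHatStep_of_eOp _ (htail (i - 1) (hsucc _ (sub_one_ne_self hℓ i)))))⟩

lemma exists_eHatReach_cons_of_reach (hℓ : 1 ≤ ℓ) {x y : (Fin m → ZMod (ℓ + 1)) × ℤ}
    (h : Relation.ReflTransGen eHatStep x y) (a : ZMod (ℓ + 1)) (c : ℤ) :
    ∃ a' c', Relation.ReflTransGen eHatStep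
      ((Fin.cons a x.1 : Fin (m + 1) → ZMod (ℓ + 1)), c) (Fin.cons a' y.1, c') := by
  induction h with
  | refl => exact ⟨a, c, .refl⟩
  | tail _ hbc ih =>
    obtain ⟨a', c', h1⟩ := ih
    obtain ⟨i, hi⟩ := hbc
    obtain ⟨a'', c'', h2⟩ := exists_eHatReach_cons hℓ (eHat_eq_some_iff.1 hi).1 a' c'
    exact ⟨a'', c'', h1.trans h2⟩

lemma exists_eHatReach_cons_const (hℓ : 1 ≤ ℓ) (a : ZMod (ℓ + 1)) (n : ℕ) :
    ∀ c : ℤ, ∃ c', Relation.ReflTransGen eHatStep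
      ((Fin.cons a (fun _ => a + n) : Fin (m + 1) → ZMod (ℓ + 1)), c) ((fun _ => a), c') := by
  have hconst : (Fin.cons a (fun _ => a) : Fin (m + 1) → ZMod (ℓ + 1)) = fun _ => a := by
    ext q
    refine Fin.cases ?_ (fun q => ?_) q <;> simp
  induction n with
  | zero =>
    intro c
    exact ⟨c, by simpa [hconst] using Relation.ReflTransGen.refl⟩
  | succ n ih =>
    intro c
    by_cases hz : ((n + 1 : ℕ) : ZMod (ℓ + 1)) = 0
    · exact ⟨c, by simpa [hz, hconst] using Relation.ReflTransGen.refl⟩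
    have h := eHatReach_lower_final_segment (m := m + 1) hℓ (a + (n + 1 : ℕ)) m 1 (by ring)
      (fun _ => a) c (fun _ _ h => hz (by simpa using h))
    have hcons : ∀ b : ZMod (ℓ + 1), (fun q : Fin (m + 1) => if (q : ℕ) < 1 then a else b) =
        Fin.cons a (fun _ => b) := fun b => by
      ext q
      refine Fin.cases ?_ (fun q => ?_) q <;> simp
    rw [hcons, hcons] at h
    obtain ⟨c', h'⟩ := ih (c + m * if a + ((n + 1 : ℕ) : ZMod (ℓ + 1)) = 0 then 1 else 0)
    refine ⟨c', h.trans ?_⟩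
    convert h' using 5
    push_cast
    ring

lemma exists_eHatReach_const_zero (hℓ : 1 ≤ ℓ) : ∀ {m : ℕ} (w : Fin m → ZMod (ℓ + 1)) (c : ℤ),
    ∃ c', Relation.ReflTransGen eHatStep (w, c) ((fun _ => 0), c') := by
  intro m
  induction m with
  | zero =>
    intro w c
    exact ⟨c, by rw [Subsingleton.elim w (fun _ => 0)]⟩
  | succ m ih =>
    intro w c
    obtain ⟨_, h1⟩ := ih (Fin.tail w) 0
    obtain ⟨a, c1, h2⟩ := exists_eHatReach_cons_of_reach hℓ h1 (w 0) c
    simp only [Fin.cons_self_tail] at h2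
    obtain ⟨c2, h3⟩ := exists_eHatReach_cons_const (m := m) hℓ a (-a).val c1
    rw [ZMod.natCast_zmod_val, add_neg_cancel] at h3
    obtain ⟨c3, h4⟩ := eHatReach_const_sub (m := m + 1) hℓ a c2 a.val
    rw [ZMod.natCast_zmod_val, sub_self] at h4
    exact ⟨c3, (h2.trans h3).trans h4⟩

lemma hatReach_const_zero_add_mul (hℓ : 1 ≤ ℓ) (c t : ℤ) :
    Relation.ReflTransGen hatStep ((fun _ : Fin m => (0 : ZMod (ℓ + 1))), c)
      ((fun _ => 0), c + m * t) := by
  induction t using Int.induction_on with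
  | zero => simpa using Relation.ReflTransGen.refl
  | succ n ih =>
    refine ih.trans ?_
    have := hatReach_of_eHatReach (eHatReach_const_zero_add (m := m) hℓ (c + m * n))
    rwa [show c + m * ((n : ℤ) + 1) = c + m * n + m by ring]
  | pred n ih =>
    refine ih.trans ?_
    have := hatReach_symm_of_eHatReach hℓ
      (eHatReach_const_zero_add (m := m) hℓ (c + m * (-(n : ℤ) - 1)))
    rwa [show c + m * (-(n : ℤ) - 1) + m = c + m * -(n : ℤ) by ring] at this

end Reachability

section MajorIndexInvariance

attribute [local instance] Classical.propDecidable

variable {ℓ m : ℕ}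

/-- The operator `e_i` undoes `f_i`. -/
lemma eOp_of_fOp (hℓ : 1 ≤ ℓ) {i : ZMod (ℓ + 1)} {w w' : Fin m → ZMod (ℓ + 1)}
    (h : fOp i w = some w') : eOp i w' = some w := by
  obtain ⟨p, hp, hi, rfl⟩ := fOp_eq_some_iff.1 h
  have hw : Function.update (Function.update w p i) p (i - 1) = w := by simp [← hi]
  have hR : ∀ q, Rf i w q = Rf i (Function.update w p i) q - (if q = p then 1 else 0)
      - (if q < p then 2 else 0) := fun q => by
    have := Rf_update hℓ (w := Function.update w p i) (p := p) (i := i) (by simp) q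
    rwa [hw] at this
  refine eOp_eq_some_iff.2 ⟨p, ⟨fun q => ?_, fun q hq => ?_⟩, by simp, hw.symm⟩
  · rcases lt_trichotomy q p with hq | rfl | hq
    · have := hp.2 q hq
      rw [hR, hR] at this
      simp [hq, hq.ne] at this
      omega
    · exact le_rfl
    · have := hp.1 q
      rw [hR, hR] at this
      simp [hq.ne', hq.not_gt] at this
      omega
  · have := hp.1 q
    rw [hR, hR] at this
    simp [hq.ne', hq.not_gt] at this
    omega

lemma val_sub_one_of_ne_zero {i : ZMod (ℓ + 1)} (hi : i ≠ 0) : (i - 1).val + 1 = i.val := by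
  have h1 : 1 ≤ i.val := Nat.one_le_iff_ne_zero.2 fun h => hi ((ZMod.val_eq_zero i).1 h)
  have h2 : (i - 1) = ((i.val - 1 : ℕ) : ZMod (ℓ + 1)) := by
    rw [Nat.cast_sub h1, ZMod.natCast_zmod_val, Nat.cast_one]
  rw [h2, ZMod.val_natCast_of_lt]
  · omega
  · have := ZMod.val_lt i
    omega

lemma val_add_one (a : ZMod (ℓ + 1)) : (a + 1).val = if a = -1 then 0 else a.val + 1 := by
  split_ifs with h
  · simp [h]
  · have h' : a + 1 ≠ 0 := fun h0 => h (eq_neg_of_add_eq_zero_left h0)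
    have := val_sub_one_of_ne_zero h'
    rw [add_sub_cancel_right] at this
    exact this.symm

/-- The operators `e_i` with `i ≠ 0` preserve descents. -/
lemma desc_eq_of_eOp (hℓ : 1 ≤ ℓ) {i : ZMod (ℓ + 1)} (h0 : i ≠ 0)
    {w w' : Fin m → ZMod (ℓ + 1)} (h : eOp i w = some w') : desc w' = desc w := by
  obtain ⟨p, hp, hi, rfl⟩ := eOp_eq_some_iff.1 h
  have hv := val_sub_one_of_ne_zero h0
  have hne : i ≠ i + 1 := fun h => by
    have := sub_one_ne_self hℓ (i + 1)
    rw [add_sub_cancel_right] at this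
    exact this h
  ext r
  simp only [desc, mem_filter, mem_univ, true_and]
  refine exists_congr fun hr => ?_
  by_cases hrp : r = p
  · subst hrp
    have hs : (⟨r + 1, hr⟩ : Fin m) ≠ r := fun h => by simp [Fin.ext_iff] at h
    rw [Function.update_of_ne hs, Function.update_self, hi]
    have hws : (w ⟨r + 1, hr⟩).val ≠ (i - 1).val := fun he => by
      have he' : w ⟨r + 1, hr⟩ = i - 1 := ZMod.val_injective _ he
      have h1 := Rf_of_succ i w (q := r) (p := ⟨r + 1, hr⟩) rfl
      have h2 := hp.2 ⟨r + 1, hr⟩ (by simp [Fin.lt_def])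
      simp [he', hi] at h1
      omega
    omega
  · rw [Function.update_of_ne hrp]
    by_cases hsp : (⟨r + 1, hr⟩ : Fin m) = p
    · subst hsp
      rw [Function.update_self, hi]
      have hwr : (w r).val ≠ i.val := fun he => by
        have he' : w r = i := ZMod.val_injective _ he
        have h1 := Rf_of_succ i w (q := r) (p := ⟨r + 1, hr⟩) rfl
        have h2 := hp.1 r
        simp only [he', hi, hne, if_true, if_false] at h1
        omega
      omega
    · rw [Function.update_of_ne hsp]

lemma majFun_eq_sum {n : ℕ} (w : Fin (n + 1) → ZMod (ℓ + 1)) :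
    MajFun w = ∑ r : Fin n,
      if (w r.succ).val < (w r.castSucc).val then (r : ℕ) + 1 else 0 := by
  unfold MajFun desc
  rw [Finset.sum_filter, Fin.sum_univ_castSucc, if_neg (by simp), add_zero]
  refine Finset.sum_congr rfl fun r _ => ?_
  refine if_congr ⟨fun ⟨_, h⟩ => h, fun h => ⟨by simp, h⟩⟩ rfl rfl

lemma sum_succ_mul_sub {n : ℕ} (g : Fin (n + 1) → ℤ) :
    ∑ r : Fin n, ((r : ℤ) + 1) * (g r.succ - g r.castSucc) =
      (n + 1) * g (Fin.last n) - ∑ r, g r := by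
  induction n with
  | zero => simp
  | succ n ih =>
    have := ih fun r => g r.castSucc
    rw [Fin.sum_univ_castSucc, Fin.sum_univ_castSucc (f := g)]
    simp only [Fin.succ_castSucc, Fin.val_castSucc, Fin.succ_last, Fin.val_last] at this ⊢
    rw [this]
    push_cast
    ring

/-- Shifting all letters cyclically changes the major index by the number of largest letters. -/
lemma dvd_majFun_add_one (w : Fin m → ZMod (ℓ + 1)) :
    (m : ℤ) ∣ (MajFun (fun p => w p + 1) : ℤ) - MajFun w + content w (-1) := by
  cases m with
  | zero => simp [MajFun, content, desc]
  | succ n =>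
    have hc : (content w (-1) : ℤ) = ∑ r, if w r = -1 then 1 else 0 := by
      simp [content]
    rw [majFun_eq_sum, majFun_eq_sum, hc]
    have hdiff : ∀ r : Fin n,
        ((if (w r.succ + 1).val < (w r.castSucc + 1).val then (r : ℤ) + 1 else 0)
          - if (w r.succ).val < (w r.castSucc).val then (r : ℤ) + 1 else 0) =
        ((r : ℤ) + 1) * ((if w r.succ = -1 then 1 else 0) -
          if w r.castSucc = -1 then 1 else 0) := by
      intro r
      have hlt : ∀ a : ZMod (ℓ + 1), a ≠ -1 → a.val < ℓ := fun a ha => by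
        have h1 := ZMod.val_lt a
        have h2 : (-1 : ZMod (ℓ + 1)).val = ℓ := ZMod.val_neg_one ℓ
        have h3 : a.val ≠ (-1 : ZMod (ℓ + 1)).val := fun h => ha (ZMod.val_injective _ h)
        omega
      rw [val_add_one, val_add_one]
      by_cases hs : w r.succ = -1 <;> by_cases hr : w r.castSucc = -1
      · simp [hs, hr]
      · have := hlt _ hr
        simp [hs, hr, this.not_gt]
      · have := hlt _ hs
        simp [hs, hr, this]
      · simp [hs, hr]
    push_cast
    rw [← Finset.sum_sub_distrib, Finset.sum_congr rfl fun r _ => hdiff r,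
      sum_succ_mul_sub fun r => if w r = -1 then (1 : ℤ) else 0, sub_add_cancel]
    exact Dvd.intro _ rfl

lemma eOp_shift {i : ZMod (ℓ + 1)} {w w' : Fin m → ZMod (ℓ + 1)} (h : eOp i w = some w') :
    eOp (i + 1) (fun p => w p + 1) = some (fun p => w' p + 1) := by
  obtain ⟨p, hp, hi, rfl⟩ := eOp_eq_some_iff.1 h
  have hR : ∀ q, Rf (i + 1) (fun p => w p + 1) q = Rf i w q := fun q => by
    simp [Rf]
  refine eOp_eq_some_iff.2 ⟨p, ?_, by simp [hi], ?_⟩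
  · simpa only [IsLastMax, hR] using hp
  · ext q
    by_cases hq : q = p
    · subst hq
      simp
    · simp [hq]

lemma content_update {w : Fin m → ZMod (ℓ + 1)} {p : Fin m} {a : ZMod (ℓ + 1)}
    (ha : a ≠ w p) : content (Function.update w p a) a = content w a + 1 := by
  have : univ.filter (fun q => Function.update w p a q = a) =
      insert p (univ.filter fun q => w q = a) := by
    ext q
    by_cases hq : q = p
    · subst hq
      simp
    · simp [hq]
  rw [content, content, this, Finset.card_insert_of_notMem (by simp [ha.symm])]

lemma dvd_majFun_sub_of_eOp (hℓ : 1 ≤ ℓ) {i : ZMod (ℓ + 1)} {w w' : Fin m → ZMod (ℓ + 1)}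
    (h : eOp i w = some w') :
    (m : ℤ) ∣ (MajFun w' : ℤ) - MajFun w - if i = 0 then 1 else 0 := by
  by_cases h0 : i = 0
  · subst h0
    have h1 := eOp_shift h
    have hz : (0 : ZMod (ℓ + 1)) + 1 ≠ 0 := fun hz => by
      have := sub_one_ne_self hℓ ((0 : ZMod (ℓ + 1)) + 1)
      rw [add_sub_cancel_right] at this
      exact this hz.symm
    have hd := desc_eq_of_eOp hℓ hz h1
    have hM : MajFun (fun p => w' p + 1) = MajFun (fun p => w p + 1) := by
      rw [MajFun, MajFun, hd]
    have h2 := dvd_majFun_add_one w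
    have h3 := dvd_majFun_add_one w'
    obtain ⟨p, hp, hi, rfl⟩ := eOp_eq_some_iff.1 h
    have hc : content (Function.update w p (0 - 1)) (-1) = content w (-1) + 1 := by
      rw [zero_sub]
      refine content_update ?_
      rw [hi, ← zero_sub]
      exact sub_one_ne_self hℓ 0
    rw [hM, hc] at h3
    obtain ⟨s, hs⟩ := h2
    obtain ⟨t, ht⟩ := h3
    refine ⟨s - t, ?_⟩
    push_cast at ht
    simp only [if_true]
    linear_combination hs - ht
  · rw [MajFun, MajFun, desc_eq_of_eOp hℓ h0 h]
    simp [h0]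

lemma dvd_of_hatStep (hℓ : 1 ≤ ℓ) {x y : (Fin m → ZMod (ℓ + 1)) × ℤ} (h : hatStep x y) :
    (m : ℤ) ∣ (y.2 - MajFun y.1) - (x.2 - MajFun x.1) := by
  obtain ⟨i, hi | hi⟩ := h
  · obtain ⟨h1, h2⟩ := eHat_eq_some_iff.1 hi
    obtain ⟨t, ht⟩ := dvd_majFun_sub_of_eOp hℓ h1
    exact ⟨-t, by linear_combination h2 - ht⟩
  · obtain ⟨h1, h2⟩ := fHat_eq_some_iff.1 hi
    obtain ⟨t, ht⟩ := dvd_majFun_sub_of_eOp hℓ (eOp_of_fOp hℓ h1)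
    exact ⟨t, by linear_combination h2 + ht⟩

lemma dvd_of_hatReach (hℓ : 1 ≤ ℓ) {x y : (Fin m → ZMod (ℓ + 1)) × ℤ}
    (h : Relation.ReflTransGen hatStep x y) :
    (m : ℤ) ∣ (y.2 - MajFun y.1) - (x.2 - MajFun x.1) := by
  induction h with
  | refl => simp
  | tail _ hbc ih =>
    have := dvd_add (dvd_of_hatStep hℓ hbc) ih
    rwa [sub_add_sub_cancel] at this

lemma majFun_const (a : ZMod (ℓ + 1)) : MajFun (fun _ : Fin m => a) = 0 := by
  simp [MajFun, desc]

/-- The component `Ô_n` is described by the major index modulo `m`. -/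
theorem mem_Ohat_iff (hℓ : 1 ≤ ℓ) (n : ℤ) (w : Fin m → ZMod (ℓ + 1)) (c : ℤ) :
    (w, c) ∈ Ohat n ↔ (m : ℤ) ∣ MajFun w - (c - n) := by
  have hiff : ∀ c' : ℤ, (m : ℤ) ∣ (c - MajFun w) - (c' - MajFun (fun _ : Fin m => (0 : ZMod (ℓ + 1))))
      ↔ (m : ℤ) ∣ MajFun w - (c - c') := fun c' => by
    rw [majFun_const, ← dvd_neg]
    ring_nf
  constructor
  · intro h
    exact (hiff n).1 (dvd_of_hatReach hℓ h)
  · intro h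
    obtain ⟨c', hc'⟩ := exists_eHatReach_const_zero hℓ w c
    have h1 := hatReach_symm_of_eHatReach hℓ hc'
    have h2 := (hiff c').1 (dvd_of_hatReach hℓ h1)
    obtain ⟨t, ht⟩ := dvd_sub h2 h
    have h3 := hatReach_const_zero_add_mul (ℓ := ℓ) (m := m) hℓ n t
    rw [← ht, show n + (MajFun w - (c - c') - (MajFun w - (c - n))) = c' by ring] at h3
    exact h3.trans h1

end MajorIndexInvariance

section MajorIndexDistribution

attribute [local instance] Classical.propDecidable

variable {I R : Type*} [Fintype I] [CommRing R]

/-- Words weakly increasing on the blocks of `b` have a distribution of contents which is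
symmetric in the letters. -/
lemma sum_blockMonotone_perm {N : ℕ} (key : I → ℕ) (hkey : Function.Injective key)
    (b : Fin N → ℕ) (hb : Monotone b) (Φ : (Fin N → I) → R)
    (hΦ : ∀ (w : Fin N → I) (s : Equiv.Perm (Fin N)), Φ (w ∘ s) = Φ w) (π : Equiv.Perm I) :
    ∑ w ∈ univ.filter (fun w : Fin N → I => Monotone fun p => toLex (b p, key (w p))),
        Φ (π ∘ w) =
      ∑ w ∈ univ.filter (fun w : Fin N → I => Monotone fun p => toLex (b p, key (w p))),
        Φ w := by
  let srt : (Fin N → I) → Equiv.Perm (Fin N) :=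
    fun u => Tuple.sort fun p => toLex (b p, key (u p))
  have hsrt : ∀ u : Fin N → I, Monotone ((fun p => toLex (b p, key (u p))) ∘ srt u) := fun u =>
    Tuple.monotone_sort _
  have hbs : ∀ u : Fin N → I, b ∘ srt u = b := fun u => by
    have h1 : Monotone (b ∘ srt u) := fun p q hpq => by
      have := Prod.Lex.monotone_fst _ _ (hsrt u hpq)
      simpa using this
    simpa using Tuple.unique_monotone (σ := srt u) (τ := 1) h1 (by simpa using hb)
  have hmono : ∀ u : Fin N → I, Monotone fun p => toLex (b p, key (u (srt u p))) := fun u => by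
    have := hsrt u
    have h2 : ((fun p => toLex (b p, key (u p))) ∘ srt u) =
        fun p => toLex (b p, key (u (srt u p))) := by
      funext p
      have := congrFun (hbs u) p
      simp only [Function.comp_apply] at this ⊢
      rw [this]
    rwa [h2] at this
  have hinv : ∀ (σ τ : Equiv.Perm I), (∀ x, τ (σ x) = x) → ∀ w : Fin N → I,
      (Monotone fun p => toLex (b p, key (w p))) →
      (τ ∘ (σ ∘ w ∘ srt (σ ∘ w))) ∘ srt (τ ∘ (σ ∘ w ∘ srt (σ ∘ w))) = w := by
    intro σ τ hστ w hw
    set s := srt (σ ∘ w) with hs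
    have hcomp : τ ∘ (σ ∘ w ∘ s) = w ∘ s := by
      funext p
      simp [hστ]
    rw [hcomp]
    set s' := srt (w ∘ s)
    have hbb : ∀ p, b (s (s' p)) = b p := fun p => by
      have h1 := congrFun (hbs (σ ∘ w)) (s' p)
      have h2 := congrFun (hbs (w ∘ s)) p
      simp only [Function.comp_apply] at h1 h2
      rw [hs, h1, h2]
    have h1 : Monotone ((fun p => toLex (b p, key (w p))) ∘ (s'.trans s)) := by
      have := hmono (w ∘ s)
      convert this using 2 with p
      simp [hbb, s']
    have h2 := Tuple.unique_monotone (τ := 1) h1 (by simpa using hw)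
    funext p
    have h3 := congrFun h2 p
    simp only [Function.comp_apply, EmbeddingLike.apply_eq_iff_eq, Prod.mk.injEq] at h3
    exact hkey (by simpa using h3.2)
  refine Finset.sum_nbij' (fun w => (π ∘ w) ∘ srt (π ∘ w))
    (fun w => (π.symm ∘ w) ∘ srt (π.symm ∘ w)) ?_ ?_ ?_ ?_ ?_
  · intro w _
    simpa using hmono (π ∘ w)
  · intro w _
    simpa using hmono (π.symm ∘ w)
  · intro w hw
    exact hinv π π.symm (by simp) w (Finset.mem_filter.1 hw).2
  · intro w hw
    exact hinv π.symm π (by simp) w (Finset.mem_filter.1 hw).2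
  · intro w _
    exact (hΦ _ _).symm

/-- Counting words with weights attached to the positions of descents is symmetric in the
letters. -/
lemma sum_descentWeight_perm {n : ℕ} (key : I → ℕ) (hkey : Function.Injective key)
    (z : Fin n → R) (Φ : (Fin (n + 1) → I) → R)
    (hΦ : ∀ (w : Fin (n + 1) → I) (s : Equiv.Perm (Fin (n + 1))), Φ (w ∘ s) = Φ w)
    (π : Equiv.Perm I) :
    ∑ w : Fin (n + 1) → I,
        (∏ r : Fin n, if key (w r.succ) < key (w r.castSucc) then z r else 1) * Φ (π ∘ w) =
      ∑ w : Fin (n + 1) → I,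
        (∏ r : Fin n, if key (w r.succ) < key (w r.castSucc) then z r else 1) * Φ w := by
  let b : Finset (Fin n) → Fin (n + 1) → ℕ := fun S p => (S.filter fun r => r.castSucc < p).card
  have hb : ∀ S, Monotone (b S) := fun S p q hpq =>
    Finset.card_le_card (Finset.monotone_filter_right _ fun r _ (hr : r.castSucc < p) =>
      hr.trans_le hpq)
  have hb_succ : ∀ S (r : Fin n), b S r.succ = b S r.castSucc + if r ∈ S then 1 else 0 := by
    intro S r
    have : (S.filter fun r' => r'.castSucc < r.succ) =
        (S.filter fun r' => r'.castSucc < r.castSucc) ∪ (S.filter fun r' => r' = r) := by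
      ext r'
      simp only [mem_filter, mem_union, Fin.lt_def, Fin.val_castSucc, Fin.val_succ, Fin.ext_iff,
        ← and_or_left]
      refine and_congr_right fun _ => ?_
      omega
    simp only [b]
    rw [this, Finset.card_union_of_disjoint, Finset.filter_eq']
    · split_ifs <;> simp
    · rw [Finset.disjoint_left]
      intro r' h1 h2
      rw [mem_filter] at h1 h2
      rw [h2.2] at h1
      exact lt_irrefl _ h1.2
  have hmono : ∀ S (w : Fin (n + 1) → I), (Monotone fun p => toLex (b S p, key (w p))) ↔
      ∀ r ∈ Sᶜ, ¬ key (w r.succ) < key (w r.castSucc) := by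
    intro S w
    rw [Fin.monotone_iff_le_succ]
    refine forall_congr' fun r => ?_
    rw [Prod.Lex.toLex_le_toLex, hb_succ, Finset.mem_compl, not_lt]
    by_cases hr : r ∈ S <;> simp [hr]
  have hexp : ∀ w : Fin (n + 1) → I,
      (∏ r : Fin n, if key (w r.succ) < key (w r.castSucc) then z r else 1) =
      ∑ S ∈ (univ : Finset (Fin n)).powerset, ((∏ r ∈ S, z r) * ∏ r ∈ Sᶜ, (1 - z r)) *
        if (Monotone fun p => toLex (b S p, key (w p))) then 1 else 0 := by
    intro w
    have h1 : ∀ r : Fin n, (if key (w r.succ) < key (w r.castSucc) then z r else 1) =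
        z r + (1 - z r) * if ¬ key (w r.succ) < key (w r.castSucc) then 1 else 0 := by
      intro r
      split_ifs <;> ring
    rw [Finset.prod_congr rfl fun r _ => h1 r, Finset.prod_add]
    refine Finset.sum_congr rfl fun S _ => ?_
    rw [Finset.prod_mul_distrib, ← Finset.compl_eq_univ_sdiff, Finset.prod_ite_zero,
      Finset.prod_const_one, if_congr (hmono S w) rfl rfl, mul_assoc]
    congr!
  simp only [hexp, Finset.sum_mul]
  rw [Finset.sum_comm, Finset.sum_comm (s := univ)]
  refine Finset.sum_congr rfl fun S _ => ?_
  have := congrArg (((∏ r ∈ S, z r) * ∏ r ∈ Sᶜ, (1 - z r)) * ·)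
    (sum_blockMonotone_perm key hkey (b S) (hb S) Φ hΦ π)
  simp only [Finset.sum_filter, Finset.mul_sum] at this
  simpa [mul_assoc] using this

end MajorIndexDistribution

section RamanujanSums

open ArithmeticFunction

lemma sum_nthRootsFinset_zpow {m : ℕ} (hm : 0 < m) (e : ℤ) :
    ∑ ζ ∈ nthRootsFinset m (1 : ℂ), ζ ^ e = if (m : ℤ) ∣ e then (m : ℂ) else 0 := by
  have hω := Complex.isPrimitiveRoot_exp m hm.ne'
  set ω := Complex.exp (2 * Real.pi * Complex.I / m)
  have hω0 : ω ≠ 0 := hω.ne_zero hm.ne'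
  split_ifs with h
  · obtain ⟨t, rfl⟩ := h
    rw [Finset.sum_congr rfl (g := fun _ => (1 : ℂ)) fun ζ hζ => by
      rw [mem_nthRootsFinset hm] at hζ
      rw [zpow_mul, zpow_natCast, hζ, one_zpow]]
    simp [hω.card_nthRootsFinset]
  · have hne : ω ^ e ≠ 1 := fun h1 => h ((hω.zpow_eq_one_iff_dvd e).1 h1)
    have hmul : ω ^ e * ∑ ζ ∈ nthRootsFinset m (1 : ℂ), ζ ^ e =
        ∑ ζ ∈ nthRootsFinset m (1 : ℂ), ζ ^ e := by
      rw [Finset.mul_sum]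
      refine Finset.sum_nbij' (fun ζ => ω * ζ) (fun ζ => ω⁻¹ * ζ) ?_ ?_ ?_ ?_ ?_
      · intro ζ hζ
        rw [mem_nthRootsFinset hm] at hζ ⊢
        rw [mul_pow, hζ, hω.pow_eq_one, one_mul]
      · intro ζ hζ
        rw [mem_nthRootsFinset hm] at hζ ⊢
        rw [mul_pow, hζ, inv_pow, hω.pow_eq_one, inv_one, one_mul]
      · intro ζ _
        rw [inv_mul_cancel_left₀ hω0]
      · intro ζ _
        rw [mul_inv_cancel_left₀ hω0]
      · intro ζ _
        rw [mul_zpow]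
    have : (ω ^ e - 1) * ∑ ζ ∈ nthRootsFinset m (1 : ℂ), ζ ^ e = 0 := by
      rw [sub_mul, one_mul, hmul, sub_self]
    exact (mul_eq_zero.1 this).resolve_left (sub_ne_zero.2 hne)

lemma sum_nthRootsFinset_eq_sum_divisors (m : ℕ) (F : ℂ → ℂ) :
    ∑ ζ ∈ nthRootsFinset m (1 : ℂ), F ζ =
      ∑ d ∈ m.divisors, ∑ ζ ∈ primitiveRoots d ℂ, F ζ := by
  classical
  rw [IsPrimitiveRoot.nthRoots_one_eq_biUnion_primitiveRoots,
    Finset.sum_biUnion fun a _ b _ h => IsPrimitiveRoot.disjoint h]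

lemma sum_primitiveRoots_eq_moebius {n : ℕ} (hn : 0 < n) :
    ∑ ζ ∈ primitiveRoots n ℂ, ζ = (moebius n : ℂ) := by
  have h1 : ∀ n > 0, ∑ d ∈ n.divisors, ∑ ζ ∈ primitiveRoots d ℂ, ζ =
      if n = 1 then (1 : ℂ) else 0 := fun n hn => by
    have := sum_nthRootsFinset_zpow hn 1
    rw [sum_nthRootsFinset_eq_sum_divisors] at this
    simp only [zpow_one] at this
    rw [this]
    have hiff : (n : ℤ) ∣ 1 ↔ n = 1 := by
      rw [← Nat.cast_one, Int.natCast_dvd_natCast, Nat.dvd_one]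
    simp only [hiff]
    split_ifs with h <;> simp [h]
  rw [sum_eq_iff_sum_mul_moebius_eq] at h1
  rw [← h1 n hn, Finset.sum_eq_single (n, 1)]
  · simp
  · rintro ⟨a, b⟩ hab hne
    rw [Nat.mem_divisorsAntidiagonal] at hab
    rw [if_neg, mul_zero]
    rintro rfl
    exact hne (by simpa using hab.1)
  · intro h
    exact absurd (by simp [hn.ne']) h

lemma sum_primitiveRoots_eq_sum_units {d : ℕ} [NeZero d] {ω : ℂ} (hω : IsPrimitiveRoot ω d)
    (F : ℂ → ℂ) :
    ∑ ζ ∈ primitiveRoots d ℂ, F ζ = ∑ u : (ZMod d)ˣ, F (ω ^ (u : ZMod d).val) := by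
  symm
  refine Finset.sum_bij (fun u _ => ω ^ (u : ZMod d).val) ?_ ?_ ?_ (fun _ _ => rfl)
  · intro u _
    rw [mem_primitiveRoots (NeZero.pos d)]
    exact hω.pow_of_coprime _ (ZMod.val_coe_unit_coprime u)
  · intro u _ v _ h
    exact Units.ext (ZMod.val_injective _
      (hω.pow_inj (ZMod.val_lt _) (ZMod.val_lt _) h))
  · intro ζ hζ
    rw [mem_primitiveRoots (NeZero.pos d)] at hζ
    obtain ⟨i, hi, hc, rfl⟩ := hω.isPrimitiveRoot_iff.1 hζ
    exact ⟨ZMod.unitOfCoprime i hc, mem_univ _, by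
      rw [ZMod.coe_unitOfCoprime, ZMod.val_natCast_of_lt hi]⟩

lemma sum_comp_eq_of_surjective {G H : Type*} [Group G] [Group H] [Fintype G] [Fintype H]
    (f : G →* H) (hf : Function.Surjective f) (F : H → ℂ) :
    ∑ x, F (f x) = (Fintype.card G : ℂ) / Fintype.card H * ∑ y, F y := by
  classical
  have hfib : ∀ y : H, (univ.filter fun x => f x = y).card =
      (univ.filter fun x => f x = 1).card := fun y =>
    MonoidHom.card_fiber_eq_of_mem_range f (hf y) (hf 1)
  have hcard : Fintype.card G = Fintype.card H * (univ.filter fun x => f x = 1).card := by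
    rw [← Finset.card_univ, Finset.card_eq_sum_card_fiberwise (f := f) (t := univ) (by simp),
      Finset.sum_congr rfl fun y _ => hfib y]
    simp
  have hH : (Fintype.card H : ℂ) ≠ 0 := by simp
  rw [← Finset.sum_fiberwise univ f fun x => F (f x), hcard, Nat.cast_mul,
    mul_div_cancel_left₀ _ hH, Finset.mul_sum]
  refine Finset.sum_congr rfl fun y _ => ?_
  rw [Finset.sum_congr rfl (g := fun _ => F y) fun x hx => by
      rw [(Finset.mem_filter.1 hx).2],
    Finset.sum_const, hfib, nsmul_eq_mul]

lemma sum_primitiveRoots_pow {d : ℕ} (hd : 0 < d) (n : ℕ) :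
    ∑ ζ ∈ primitiveRoots d ℂ, ζ ^ n =
      (d.totient : ℂ) * moebius (d / d.gcd n) / (d / d.gcd n).totient := by
  have hd0 : NeZero d := ⟨hd.ne'⟩
  have hω := Complex.isPrimitiveRoot_exp d hd.ne'
  set ω := Complex.exp (2 * Real.pi * Complex.I / d)
  have hg : 0 < d.gcd n := Nat.gcd_pos_of_pos_left n hd
  obtain ⟨N, hN⟩ : d.gcd n ∣ d := Nat.gcd_dvd_left d n
  obtain ⟨b, hb⟩ : d.gcd n ∣ n := Nat.gcd_dvd_right d n
  have hdiv : d / d.gcd n = N := Nat.div_eq_of_eq_mul_right hg hN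
  have hndiv : n / d.gcd n = b := Nat.div_eq_of_eq_mul_right hg hb
  have hcop : b.Coprime N := by
    have := Nat.coprime_div_gcd_div_gcd (m := d) (n := n) hg
    rw [hdiv, hndiv] at this
    exact this.symm
  have hN0 : 0 < N := Nat.pos_of_ne_zero fun h => hd.ne' (by rw [hN, h, mul_zero])
  have : NeZero N := ⟨hN0.ne'⟩
  have hη : IsPrimitiveRoot (ω ^ n) N := by
    have := (hω.pow hd hN).pow_of_coprime b hcop
    rwa [← pow_mul, ← hb] at this
  have hNd : N ∣ d := Dvd.intro_left _ hN.symm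
  rw [hdiv, sum_primitiveRoots_eq_sum_units hω]
  have hcomp : ∀ u : (ZMod d)ˣ, (ω ^ (u : ZMod d).val) ^ n =
      (ω ^ n) ^ ((ZMod.unitsMap hNd u : (ZMod N)ˣ) : ZMod N).val := fun u => by
    rw [ZMod.unitsMap_val, ← pow_mul, mul_comm, pow_mul, ZMod.cast_eq_val, ZMod.val_natCast]
    exact pow_eq_pow_mod _ hη.pow_eq_one
  rw [Finset.sum_congr rfl fun u _ => hcomp u,
    sum_comp_eq_of_surjective (ZMod.unitsMap hNd) (ZMod.unitsMap_surjective hNd)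
      fun v => (ω ^ n) ^ (v : ZMod N).val,
    ← sum_primitiveRoots_eq_sum_units hη fun ζ => ζ, sum_primitiveRoots_eq_moebius hN0,
    ZMod.card_units_eq_totient, ZMod.card_units_eq_totient]
  ring

/-- The evaluation of Ramanujan sums. -/
lemma sum_primitiveRoots_zpow {d : ℕ} (hd : 0 < d) (e : ℤ) :
    ∑ ζ ∈ primitiveRoots d ℂ, ζ ^ e = (phiInt e d : ℂ) := by
  have key : ∑ ζ ∈ primitiveRoots d ℂ, ζ ^ e.natAbs = (phiInt e d : ℂ) := by
    rw [sum_primitiveRoots_pow hd]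
    simp [phiInt]
  rw [← key]
  rcases Int.natAbs_eq e with h | h
  · refine Finset.sum_congr rfl fun ζ _ => ?_
    conv_lhs => rw [h, zpow_natCast]
  · refine Finset.sum_nbij' (fun ζ => ζ⁻¹) (fun ζ => ζ⁻¹) ?_ ?_ ?_ ?_ ?_
    · intro ζ hζ
      rw [mem_primitiveRoots hd] at hζ ⊢
      exact hζ.inv
    · intro ζ hζ
      rw [mem_primitiveRoots hd] at hζ ⊢
      exact hζ.inv
    · exact fun ζ _ => inv_inv ζ
    · exact fun ζ _ => inv_inv ζ
    · intro ζ _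
      conv_lhs => rw [h, zpow_neg, zpow_natCast]
      rw [inv_pow]

end RamanujanSums

section MajorIndexGeneratingFunction

attribute [local instance] Classical.propDecidable

variable {ℓ : ℕ}

/-- The generating function of the major index on the words of content `k`, evaluated at `ζ`. -/
def majGen (ζ : ℂ) (d : ℕ) (k : ZMod (ℓ + 1) → ℕ) : ℂ :=
  ∑ w : Fin d → ZMod (ℓ + 1), if content w = k then ζ ^ MajFun w else 0

lemma content_comp_perm {m : ℕ} (w : Fin m → ZMod (ℓ + 1)) (s : Equiv.Perm (Fin m)) :
    content (w ∘ s) = content w := by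
  funext j
  unfold content
  exact Finset.card_equiv s (by simp)

lemma content_perm_comp_eq_iff {m : ℕ} (w : Fin m → ZMod (ℓ + 1))
    (π : Equiv.Perm (ZMod (ℓ + 1))) (k : ZMod (ℓ + 1) → ℕ) :
    content (π ∘ w) = k ↔ content w = k ∘ π := by
  have : content (π ∘ w) ∘ π = content w := by
    funext j
    simp [content]
  rw [← this]
  exact (Function.Surjective.right_cancellable π.surjective).symm

lemma pow_majFun_eq_prod (ζ : ℂ) {n : ℕ} (w : Fin (n + 1) → ZMod (ℓ + 1)) :
    ζ ^ MajFun w =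
      ∏ r : Fin n, if (w r.succ).val < (w r.castSucc).val then ζ ^ ((r : ℕ) + 1) else 1 := by
  rw [majFun_eq_sum, ← Finset.prod_pow_eq_pow_sum]
  refine Finset.prod_congr rfl fun r _ => ?_
  split_ifs <;> simp

lemma majGen_comp_perm (ζ : ℂ) {d : ℕ} (hd : 0 < d) (k : ZMod (ℓ + 1) → ℕ)
    (π : Equiv.Perm (ZMod (ℓ + 1))) : majGen ζ d (k ∘ π) = majGen ζ d k := by
  obtain ⟨n, rfl⟩ : ∃ n, d = n + 1 := ⟨d - 1, by omega⟩
  have := sum_descentWeight_perm (R := ℂ) (ZMod.val (n := ℓ + 1)) (ZMod.val_injective _)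
    (fun r : Fin n => ζ ^ ((r : ℕ) + 1)) (fun w => if content w = k then 1 else 0)
    (fun w s => by rw [content_comp_perm]) π
  simp only [content_perm_comp_eq_iff, mul_ite, mul_one, mul_zero] at this
  simp only [majGen, pow_majFun_eq_prod]
  exact this

lemma pow_mul_majGen {ζ : ℂ} {d : ℕ} (hd : 0 < d) (hζ : ζ ^ d = 1) (k : ZMod (ℓ + 1) → ℕ) :
    ζ ^ k 0 * majGen ζ d k = majGen ζ d k := by
  let π : Equiv.Perm (ZMod (ℓ + 1)) := Equiv.addRight 1
  rw [← majGen_comp_perm ζ hd k π]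
  conv_lhs => rw [majGen_comp_perm ζ hd k π]
  unfold majGen
  rw [← Equiv.sum_comp (Equiv.arrowCongr (Equiv.refl (Fin d)) π), Finset.mul_sum]
  refine Finset.sum_congr rfl fun w _ => ?_
  have h1 : (Equiv.arrowCongr (Equiv.refl (Fin d)) π) w = π ∘ w := by
    funext p; simp
  rw [h1, mul_ite, mul_zero]
  refine if_ctx_congr (content_perm_comp_eq_iff w π k) (fun h => ?_) fun _ => rfl
  have h2 : k 0 = content w (-1) := by
    rw [h]; simp [π]
  have h3 := dvd_majFun_add_one w
  have hζ0 : ζ ≠ 0 := fun h0 => by simp [h0, hd.ne'] at hζ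
  obtain ⟨t, ht⟩ := h3
  have h4 : (MajFun (π ∘ w) : ℤ) + content w (-1) = MajFun w + d * t := by
    have h5 : π ∘ w = fun p => w p + 1 := by
      funext p; simp [π]
    rw [h5]
    linarith
  rw [h2, ← pow_add, ← zpow_natCast, ← zpow_natCast]
  push_cast
  rw [add_comm, h4, zpow_add₀ hζ0, zpow_mul, zpow_natCast ζ d, hζ, one_zpow, mul_one]

lemma majGen_eq_zero {ζ : ℂ} {d : ℕ} (hd : 0 < d) (hζ : IsPrimitiveRoot ζ d)
    {k : ZMod (ℓ + 1) → ℕ} {j : ZMod (ℓ + 1)} (hj : ¬ d ∣ k j) : majGen ζ d k = 0 := by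
  have h := pow_mul_majGen hd hζ.pow_eq_one (k ∘ Equiv.swap 0 j)
  rw [majGen_comp_perm ζ hd] at h
  simp only [Function.comp_apply, Equiv.swap_apply_left] at h
  by_contra h0
  exact hj ((hζ.pow_eq_one_iff_dvd _).1 (mul_eq_right₀ h0 |>.1 h))

/-- The generating function of all words of length `d` by content and major index, the latter
evaluated at `ζ`. -/
noncomputable def majPoly (ℓ : ℕ) (ζ : ℂ) (d : ℕ) : MvPolynomial (ZMod (ℓ + 1)) ℂ :=
  ∑ w : Fin d → ZMod (ℓ + 1), MvPolynomial.C (ζ ^ MajFun w) * ∏ p, MvPolynomial.X (w p)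

lemma coeff_majPoly (ζ : ℂ) (d : ℕ) (s : ZMod (ℓ + 1) →₀ ℕ) :
    (majPoly ℓ ζ d).coeff s = majGen ζ d s := by
  rw [majPoly, majGen, MvPolynomial.coeff_sum]
  refine Finset.sum_congr rfl fun w _ => ?_
  have h1 : (∏ p, MvPolynomial.X (w p) : MvPolynomial (ZMod (ℓ + 1)) ℂ) =
      MvPolynomial.monomial (∑ p, Finsupp.single (w p) 1) 1 := by
    rw [MvPolynomial.monomial_sum_one]
    rfl
  have h2 : (∑ p, Finsupp.single (w p) 1 = s) ↔ content w = s := by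
    rw [← DFunLike.coe_fn_eq]
    have : ((∑ p, Finsupp.single (w p) 1 : ZMod (ℓ + 1) →₀ ℕ) : ZMod (ℓ + 1) → ℕ) =
        content w := by
      funext j
      simp [content, Finsupp.finsetSum_apply, Finsupp.single_apply]
    rw [this]
  rw [h1, MvPolynomial.coeff_C_mul, MvPolynomial.coeff_monomial, mul_ite, mul_one, mul_zero]
  simp only [h2]

lemma content_const {d : ℕ} (j : ZMod (ℓ + 1)) :
    content (fun _ : Fin d => j) = Finsupp.single j d := by
  funext i
  simp only [content, Finsupp.single_apply]
  split_ifs with h <;> simp [h]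

lemma majPoly_of_isPrimitiveRoot {ζ : ℂ} {d : ℕ} (hd : 0 < d) (hζ : IsPrimitiveRoot ζ d) :
    majPoly ℓ ζ d = ∑ j, MvPolynomial.X j ^ d := by
  ext s
  rw [coeff_majPoly, MvPolynomial.coeff_sum]
  simp only [MvPolynomial.coeff_X_pow]
  by_cases hs : ∀ j, d ∣ s j
  · symm
    refine Finset.sum_of_injOn (fun j _ => j) ?_ (by simp) ?_ ?_
    · intro i _ j _ h
      exact congrFun h ⟨0, hd⟩
    · intro w _ hw
      rw [if_neg]
      intro hc
      apply hw
      refine ⟨w ⟨0, hd⟩, by simp, ?_⟩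
      have h1 : 0 < s (w ⟨0, hd⟩) := by
        rw [← hc]
        exact Finset.card_pos.2 ⟨⟨0, hd⟩, by simp⟩
      have h2 := Nat.le_of_dvd h1 (hs _)
      rw [← hc] at h2
      have h3 : (univ.filter fun p => w p = w ⟨0, hd⟩) = univ :=
        Finset.eq_univ_of_card _ (le_antisymm (Finset.card_le_univ _) (by simpa [content] using h2))
      funext p
      have := Finset.mem_univ p
      rw [← h3, Finset.mem_filter] at this
      exact this.2.symm
    · intro j _
      simp only [content_const, majFun_const, pow_zero, DFunLike.coe_fn_eq]
  · push Not at hs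
    obtain ⟨j, hj⟩ := hs
    rw [majGen_eq_zero hd hζ hj]
    refine (Finset.sum_eq_zero fun i _ => if_neg ?_).symm
    rintro rfl
    apply hj
    rw [Finsupp.single_apply]
    split_ifs <;> simp

lemma dvd_majFun_append {a b : ℕ} (u : Fin a → ZMod (ℓ + 1)) (v : Fin b → ZMod (ℓ + 1)) :
    (a : ℤ) ∣ (MajFun (Fin.append u v) : ℤ) - (MajFun u + MajFun v) := by
  simp only [MajFun, desc, Finset.sum_filter]
  rw [Fin.sum_univ_add]
  push_cast
  rw [add_sub_add_comm, ← Finset.sum_sub_distrib, ← Finset.sum_sub_distrib]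
  refine dvd_add (Finset.dvd_sum fun r _ => ?_) (Finset.dvd_sum fun r _ => ?_)
  · by_cases hr : (r : ℕ) + 1 < a
    · have h1 : ∀ h : (r : ℕ) + 1 < a + b,
          Fin.append u v ⟨(r : ℕ) + 1, h⟩ = u ⟨(r : ℕ) + 1, hr⟩ := fun h =>
        Fin.append_left u v ⟨(r : ℕ) + 1, hr⟩
      have h2 : (r : ℕ) + 1 < a + b := by omega
      simp [hr, h1, h2]
    · have h1 : (r : ℤ) + 1 = a := by
        have := r.2
        omega
      simp only [hr, Fin.val_castAdd, IsEmpty.exists_iff, if_false, h1]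
      split_ifs <;> simp
  · have h1 : ∀ (h : a + (r : ℕ) + 1 < a + b) (h' : (r : ℕ) + 1 < b),
        Fin.append u v ⟨a + (r : ℕ) + 1, h⟩ = v ⟨(r : ℕ) + 1, h'⟩ := fun h h' =>
      Fin.append_right u v ⟨(r : ℕ) + 1, h'⟩
    by_cases hr : (r : ℕ) + 1 < b
    · have h2 : a + (r : ℕ) + 1 < a + b := by omega
      simp only [Fin.val_natAdd, h1 h2 hr, h2, hr, Fin.append_right, exists_true_left]
      split_ifs <;> simp [add_assoc]
    · have h2 : ¬ a + (r : ℕ) + 1 < a + b := by omega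
      simp [hr, h2]

lemma majPoly_add {ζ : ℂ} {a : ℕ} (b : ℕ) (hζ0 : ζ ≠ 0) (hζ : ζ ^ a = 1) :
    majPoly ℓ ζ (a + b) = majPoly ℓ ζ a * majPoly ℓ ζ b := by
  unfold majPoly
  rw [← Equiv.sum_comp (Fin.appendEquiv a b), Fintype.sum_prod_type, Finset.sum_mul_sum]
  refine Finset.sum_congr rfl fun u _ => Finset.sum_congr rfl fun v _ => ?_
  have h1 : ζ ^ MajFun (Fin.append u v) = ζ ^ MajFun u * ζ ^ MajFun v := by
    obtain ⟨t, ht⟩ := dvd_majFun_append u v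
    have h2 : (MajFun (Fin.append u v) : ℤ) = (MajFun u + MajFun v : ℕ) + a * t := by
      push_cast
      rw [← ht]
      ring
    rw [← pow_add, ← zpow_natCast, h2, zpow_add₀ hζ0, zpow_mul, zpow_natCast ζ a, hζ, one_zpow,
      mul_one, zpow_natCast]
  change MvPolynomial.C (ζ ^ MajFun (Fin.append u v)) *
    ∏ p, MvPolynomial.X (Fin.append u v p) = _
  rw [h1, Fin.prod_univ_add, MvPolynomial.C_mul]
  simp only [Fin.append_left, Fin.append_right]
  ring

lemma majPoly_mul {ζ : ℂ} {d : ℕ} (hd : 0 < d) (hζ : IsPrimitiveRoot ζ d) (t : ℕ) :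
    majPoly ℓ ζ (d * t) = (∑ j, MvPolynomial.X j ^ d) ^ t := by
  induction t with
  | zero => simp [majPoly, MajFun, desc]
  | succ t ih =>
    rw [pow_succ, ← ih, ← majPoly_of_isPrimitiveRoot hd hζ]
    have h : ζ ^ (d * t) = 1 := by rw [pow_mul, hζ.pow_eq_one, one_pow]
    exact majPoly_add d (hζ.ne_zero hd.ne') h

lemma majGen_of_isPrimitiveRoot {ζ : ℂ} {d m : ℕ} (hd : 0 < d) (hζ : IsPrimitiveRoot ζ d)
    (hdm : d ∣ m) {k : ZMod (ℓ + 1) → ℕ} (hk : ∑ j, k j = m) :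
    majGen ζ m k = if ∀ j, d ∣ k j then
      ((m / d).factorial : ℂ) / ∏ j, ((k j / d).factorial : ℂ) else 0 := by
  obtain ⟨t, rfl⟩ := hdm
  have h0 : majGen ζ (d * t) k =
      (MvPolynomial.expand d ((∑ j, MvPolynomial.X j) ^ t : MvPolynomial (ZMod (ℓ + 1)) ℂ)).coeff
        (Finsupp.equivFunOnFinite.symm k) := by
    rw [map_pow, map_sum]
    simp only [MvPolynomial.expand_X]
    rw [← majPoly_mul hd hζ, coeff_majPoly]
    rfl
  rw [h0]
  split_ifs with h
  · choose q hq using h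
    have h1 : Finsupp.equivFunOnFinite.symm k = d • Finsupp.equivFunOnFinite.symm q := by
      ext j
      simp [hq]
    have hqt : ∑ j, q j = t := by
      simp only [hq, ← Finset.mul_sum] at hk
      exact Nat.eq_of_mul_eq_mul_left hd hk
    rw [h1, MvPolynomial.coeff_expand_smul _ hd.ne', MvPolynomial.coeff_sum_X_pow_of_fintype,
      if_pos (by simpa [Finsupp.sum_fintype] using hqt),
      Finsupp.multinomial_eq_of_support_subset (Finset.subset_univ _)]
    have h2 := Nat.multinomial_spec univ q
    rw [hqt] at h2
    have h3 : (∏ j, ((q j).factorial : ℂ)) ≠ 0 :=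
      Finset.prod_ne_zero_iff.2 fun j _ => by exact_mod_cast (q j).factorial_ne_zero
    simp only [hq, Nat.mul_div_cancel_left _ hd]
    rw [eq_div_iff h3, mul_comm]
    exact_mod_cast h2
  · push Not at h
    obtain ⟨j, hj⟩ := h
    exact MvPolynomial.coeff_expand_of_not_dvd _ (i := j) (by simpa using hj)

end MajorIndexGeneratingFunction

section Counting

attribute [local instance] Classical.propDecidable

variable {ℓ : ℕ}

lemma mul_card_eq_sum_majGen {m : ℕ} (hm : 0 < m) (e : ℤ) (k : ZMod (ℓ + 1) → ℕ) :
    (m : ℂ) * (univ.filter fun w : Fin m → ZMod (ℓ + 1) =>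
        content w = k ∧ (m : ℤ) ∣ MajFun w - e).card =
      ∑ ζ ∈ nthRootsFinset m (1 : ℂ), ζ ^ (-e) * majGen ζ m k := by
  simp only [majGen, Finset.mul_sum]
  rw [Finset.sum_comm, Finset.card_filter]
  push_cast
  rw [Finset.mul_sum]
  refine Finset.sum_congr rfl fun w _ => ?_
  by_cases hw : content w = k
  · simp only [hw, true_and, if_true]
    rw [mul_ite, mul_one, mul_zero, ← sum_nthRootsFinset_zpow hm]
    refine Finset.sum_congr rfl fun ζ hζ => ?_
    have hζ0 : ζ ≠ 0 := fun h0 => by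
      rw [mem_nthRootsFinset hm] at hζ
      simp [h0, hm.ne'] at hζ
    rw [sub_eq_neg_add, zpow_add₀ hζ0, zpow_natCast]
  · simp [hw]

lemma phiInt_neg (e : ℤ) (d : ℕ) : phiInt (-e) d = phiInt e d := by
  simp [phiInt]

lemma mul_card_eq_sum_phiInt {m : ℕ} (hm : 0 < m) (e : ℤ) (k : ZMod (ℓ + 1) → ℕ)
    (hk : ∑ j, k j = m) :
    (m : ℚ) * (univ.filter fun w : Fin m → ZMod (ℓ + 1) =>
        content w = k ∧ (m : ℤ) ∣ MajFun w - e).card =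
      ∑ d ∈ (univ.gcd k).divisors,
          phiInt e d * (((m / d).factorial : ℚ) / ∏ j, ((k j / d).factorial : ℚ)) := by
  have hdvd : ∀ d, d ∣ univ.gcd k ↔ ∀ j, d ∣ k j := fun d => by simp [Finset.dvd_gcd_iff]
  have hgm : univ.gcd k ∣ m := hk ▸ Finset.dvd_sum fun j hj => Finset.gcd_dvd hj
  have h : (m : ℂ) * (univ.filter fun w : Fin m → ZMod (ℓ + 1) =>
        content w = k ∧ (m : ℤ) ∣ MajFun w - e).card =
      ∑ d ∈ (univ.gcd k).divisors,
        (phiInt e d : ℂ) * (((m / d).factorial : ℂ) / ∏ j, ((k j / d).factorial : ℂ)) := by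
    rw [mul_card_eq_sum_majGen hm, sum_nthRootsFinset_eq_sum_divisors]
    symm
    refine Finset.sum_subset_zero_on_sdiff (Nat.divisors_subset_of_dvd hm.ne' hgm) ?_ ?_
    · intro d hd
      rw [Finset.mem_sdiff, Nat.mem_divisors, Nat.mem_divisors, hdvd] at hd
      refine Finset.sum_eq_zero fun ζ hζ => ?_
      have hd0 := Nat.pos_of_dvd_of_pos hd.1.1 hm
      rw [majGen_of_isPrimitiveRoot hd0 ((mem_primitiveRoots hd0).1 hζ) hd.1.1 hk,
        if_neg fun h => hd.2 ⟨h, (Nat.pos_of_dvd_of_pos hgm hm).ne'⟩, mul_zero]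
    · intro d hd
      rw [Nat.mem_divisors] at hd
      have hdm := hd.1.trans hgm
      have hd0 := Nat.pos_of_dvd_of_pos hdm hm
      rw [← phiInt_neg, ← sum_primitiveRoots_zpow hd0, Finset.sum_mul]
      refine Finset.sum_congr rfl fun ζ hζ => ?_
      rw [majGen_of_isPrimitiveRoot hd0 ((mem_primitiveRoots hd0).1 hζ) hdm hk,
        if_pos ((hdvd d).1 hd.1)]
  apply Rat.cast_injective (α := ℂ)
  push_cast
  exact h

end Counting

/-- for `0 ≤ n < m`, `c ∈ ℤ`, and a content `(k_0,…,k_ℓ)` with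
`k_0 + ⋯ + k_ℓ = m`, the number of words `w` of length `m` with content
`(k_j)` such that `(w, c) ∈ Ô_n` equals
`(1/m) Σ_{d ∣ gcd(k_0,…,k_ℓ)} φ_{c−n}(d) · (m/d)!/((k_0/d)!⋯(k_ℓ/d)!)`. -/
theorem stmt_0 (ℓ m : ℕ) (hℓ : 1 ≤ ℓ) (hm : 1 ≤ m)
    (n : ℕ) (hn : n < m) (c : ℤ)
    (k : ZMod (ℓ + 1) → ℕ) (hk : ∑ j, k j = m) :
    ({w : Fin m → ZMod (ℓ + 1) |
        (∀ j, content w j = k j) ∧ (w, c) ∈ Ohat (n : ℤ)}.ncard : ℚ)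
      = (1 / (m : ℚ)) * ∑ d ∈ (univ.gcd k).divisors,
          phiInt (c - (n : ℤ)) d *
            (((m / d).factorial : ℚ) / ∏ j, ((k j / d).factorial : ℚ)) := by
  classical
  have hm0 : (m : ℚ) ≠ 0 := by exact_mod_cast (show m ≠ 0 by omega)
  rw [← mul_card_eq_sum_phiInt hm (c - n) k hk, one_div, inv_mul_cancel_left₀ hm0,
    ← Set.ncard_coe_finset]
  congr 2
  ext w
  simp [mem_Ohat_iff hℓ, funext_iff]

end GreensteinPaths
end

section
/- Let (k_0,…,k_ℓ) be nonnegative integers with k_0 + ⋯ + k_ℓ = m and let n ∈ {0,…,m−1}. Then the number of words w of length m with content (k_0,…,k_ℓ) and N(w) ≡ −n (mod m) equals the coefficient of q^n in the remainder of the Gaussian multinomial [m; k_0,…,k_ℓ]_q upon division by q^m − 1 in ℤ[q]. -/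
open Finset Polynomial

namespace GreensteinPaths

noncomputable section

attribute [local instance] Classical.propDecidable

variable {ℓ m : ℕ}

end

section MacMahon

/-! ### MacMahon's theorem on the major index of words with a fixed content -/

lemma qNat_add (a b : ℕ) : qNat (a + b) = qNat a + X ^ a * qNat b := by
  simp only [qNat, Finset.sum_range_add, Finset.mul_sum, pow_add]

lemma qNat_zero : qNat 0 = 0 := by simp [qNat]

lemma qFactorial_zero : qFactorial 0 = 1 := by simp [qFactorial]

lemma qFactorial_succ (n : ℕ) : qFactorial (n + 1) = qFactorial n * qNat (n + 1) := by
  simp [qFactorial, Finset.prod_range_succ]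

lemma monic_qFactorial (n : ℕ) : (qFactorial n).Monic :=
  monic_prod_of_monic _ _ fun i _ => monic_geom_sum_X i.succ_ne_zero

variable {α : Type*} [LinearOrder α]

lemma sum_X_pow_mul_qNat (s : Finset α) (k : α → ℕ) :
    ∑ j ∈ s, X ^ (∑ a ∈ s with j < a, k a) * qNat (k j) = qNat (∑ j ∈ s, k j) := by
  induction s using Finset.induction_on_min with
  | empty => simp [qNat_zero]
  | insert a s has ih =>
    have ha : a ∉ s := fun h => lt_irrefl a (has a h)
    rw [Finset.sum_insert ha, Finset.sum_insert ha, add_comm (k a), qNat_add, ← ih, add_comm]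
    congr 1
    · refine Finset.sum_congr rfl fun j hj => ?_
      rw [Finset.filter_insert, if_neg (has j hj).not_gt]
    · rw [Finset.filter_insert, if_neg (lt_irrefl a), Finset.filter_true_of_mem has]

variable [Fintype α]

lemma sum_ite_X_pow_mul_qNat (k : α → ℕ) (i : α) :
    ∑ j, (if i < j then X ^ (∑ a, k a) else 1) * (X ^ (∑ a with j < a, k a) * qNat (k j))
      = X ^ (∑ a with i < a, k a) * qNat (∑ a, k a) := by
  have hsplit := Finset.sum_filter_add_sum_filter_not univ (i < ·) k
  rw [← Finset.sum_filter_add_sum_filter_not univ (i < ·)]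
  have hgt : ∑ j with i < j, (if i < j then (X : ℤ[X]) ^ (∑ a, k a) else 1) *
      (X ^ (∑ a with j < a, k a) * qNat (k j))
      = X ^ (∑ a, k a) * qNat (∑ a with i < a, k a) := by
    rw [← sum_X_pow_mul_qNat {a | i < a} k, Finset.mul_sum]
    refine Finset.sum_congr rfl fun j hj => ?_
    have hj : i < j := by simpa using hj
    rw [if_pos hj, Finset.filter_filter]
    congr! 5 with a
    exact ⟨fun h => ⟨hj.trans h, h⟩, And.right⟩
  have hle : ∑ j with ¬ i < j, (if i < j then (X : ℤ[X]) ^ (∑ a, k a) else 1) *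
      (X ^ (∑ a with j < a, k a) * qNat (k j))
      = X ^ (∑ a with i < a, k a) * qNat (∑ a with ¬ i < a, k a) := by
    rw [← sum_X_pow_mul_qNat {a | ¬ i < a} k, Finset.mul_sum]
    refine Finset.sum_congr rfl fun j hj => ?_
    have hj : ¬ i < j := by simpa using hj
    rw [if_neg hj, one_mul, ← mul_assoc, ← pow_add]
    congr 2
    rw [← Finset.sum_filter_add_sum_filter_not {a | j < a} (i < ·), Finset.filter_filter,
      Finset.filter_filter, Finset.filter_filter]
    congr! 3 with a a
    · exact ⟨And.right, fun h => ⟨(not_lt.1 hj).trans_lt h, h⟩⟩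
    · exact and_comm
  rw [hgt, hle, ← hsplit, qNat_add, pow_add]
  nth_rewrite 2 [add_comm]
  have hcomm := qNat_add (∑ a with i < a, k a) (∑ a with ¬ i < a, k a)
  rw [add_comm, qNat_add] at hcomm
  linear_combination X ^ (∑ a with i < a, k a) * hcomm

/-- The number of occurrences of each letter in a word. -/
def letterCount {n : ℕ} (w : Fin n → α) (j : α) : ℕ := #{p | w p = j}

/-- The major index of a nonempty word over a linearly ordered alphabet. -/
def majorIndex {n : ℕ} (w : Fin (n + 1) → α) : ℕ :=
  ∑ r : Fin n, if w r.succ < w r.castSucc then (r : ℕ) + 1 else 0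

omit [Fintype α] in
lemma letterCount_snoc {n : ℕ} (w : Fin n → α) (i : α) :
    letterCount (Fin.snoc w i : Fin (n + 1) → α) = letterCount w + Pi.single i 1 := by
  ext j
  simp only [letterCount, Finset.card_filter, Fin.sum_univ_castSucc, Fin.snoc_castSucc,
    Fin.snoc_last, Pi.add_apply, Pi.single_apply, eq_comm (a := i)]

omit [Fintype α] in
lemma majorIndex_snoc {n : ℕ} (w : Fin (n + 1) → α) (i : α) :
    majorIndex (Fin.snoc w i : Fin (n + 2) → α)
      = majorIndex w + if i < w (Fin.last n) then n + 1 else 0 := by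
  simp only [majorIndex, Fin.sum_univ_castSucc, Fin.snoc_castSucc, Fin.succ_last, Fin.snoc_last,
    ← Fin.castSucc_succ, Fin.val_castSucc, Fin.val_last]

/-- The generating function of the major index over the words of length `n + 1` with content `k`
and last letter `i`. -/
noncomputable def majorGenFun (n : ℕ) (k : α → ℕ) (i : α) : ℤ[X] :=
  ∑ w : Fin (n + 1) → α,
    if letterCount w = k ∧ w (Fin.last n) = i then X ^ majorIndex w else 0

lemma majorGenFun_eq_sum_snoc (n : ℕ) (k : α → ℕ) (i : α) :
    majorGenFun n (k + Pi.single i 1) i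
      = ∑ w : Fin n → α, if letterCount w = k then
          X ^ majorIndex (Fin.snoc w i : Fin (n + 1) → α) else 0 := by
  rw [majorGenFun, ← (Fin.snocEquiv fun _ => α).sum_comp, Fintype.sum_prod_type,
    Finset.sum_eq_single i]
  · simp [Fin.snocEquiv, letterCount_snoc]
  · intro j _ hj
    simp [Fin.snocEquiv, hj]
  · simp

lemma majorGenFun_succ (n : ℕ) (k : α → ℕ) (i : α) :
    majorGenFun (n + 1) (k + Pi.single i 1) i
      = ∑ j, (if i < j then X ^ (n + 1) else 1) * majorGenFun n k j := by
  rw [majorGenFun_eq_sum_snoc]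
  simp only [majorGenFun, Finset.mul_sum]
  rw [Finset.sum_comm]
  refine Finset.sum_congr rfl fun w _ => ?_
  rw [Finset.sum_eq_single (w (Fin.last n))]
  · simp only [and_true, majorIndex_snoc]
    split_ifs <;> simp [pow_add, mul_comm]
  · intro j _ hj
    simp [hj.symm]
  · simp

lemma majorGenFun_eq_zero {n : ℕ} {k : α → ℕ} {i : α} (hi : k i = 0) :
    majorGenFun n k i = 0 := by
  refine Finset.sum_eq_zero fun w _ => if_neg ?_
  rintro ⟨rfl, h⟩
  simp only [letterCount, Finset.card_eq_zero, Finset.filter_eq_empty_iff] at hi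
  exact hi (mem_univ _) h

omit [LinearOrder α] in
lemma prod_qFactorial_add_single [DecidableEq α] (k : α → ℕ) (i : α) :
    ∏ j, qFactorial ((k + Pi.single i 1 : α → ℕ) j) = qNat (k i + 1) * ∏ j, qFactorial (k j) := by
  rw [← Finset.mul_prod_erase _ _ (mem_univ i),
    ← Finset.mul_prod_erase _ (fun j => qFactorial (k j))
    (mem_univ i), Pi.add_apply, Pi.single_eq_same, qFactorial_succ]
  rw [Finset.prod_congr rfl (g := fun j => qFactorial (k j))]
  · ring
  · intro j hj
    rw [Pi.add_apply, Pi.single_eq_of_ne (Finset.ne_of_mem_erase hj), add_zero]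

lemma sum_filter_lt_add_single (k : α → ℕ) (i : α) :
    ∑ a with i < a, (k + Pi.single i 1 : α → ℕ) a = ∑ a with i < a, k a :=
  Finset.sum_congr rfl fun a ha => by
    rw [Pi.add_apply, Pi.single_eq_of_ne (by simpa using (mem_filter.1 ha).2.ne'), add_zero]

omit [Fintype α] in
lemma exists_eq_add_single {k : α → ℕ} {i : α} (hi : k i ≠ 0) :
    ∃ k' : α → ℕ, k = k' + Pi.single i 1 := by
  refine ⟨k - Pi.single i 1, funext fun j => ?_⟩
  by_cases h : j = i
  · subst h
    simp [Nat.sub_add_cancel (Nat.pos_of_ne_zero hi)]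
  · simp [h]

theorem majorGenFun_mul_prod (n : ℕ) (k : α → ℕ) (hk : ∑ j, k j = n + 1) (i : α) :
    majorGenFun n k i * ∏ j, qFactorial (k j)
      = X ^ (∑ a with i < a, k a) * qNat (k i) * qFactorial n := by
  induction n generalizing k i with
  | zero =>
    by_cases hi : k i = 0
    · simp [majorGenFun_eq_zero hi, hi, qNat_zero]
    · obtain ⟨k, rfl⟩ : ∃ k' : α → ℕ, k = k' + Pi.single i 1 :=
        exists_eq_add_single hi
      have hk0 : k = 0 := by
        ext j
        simpa [Finset.sum_add_distrib] using Finset.sum_eq_zero_iff.1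
          (by simpa [Finset.sum_add_distrib] using hk : ∑ j, k j = 0) j (mem_univ j)
      subst hk0
      rw [majorGenFun_eq_sum_snoc, prod_qFactorial_add_single, sum_filter_lt_add_single]
      have : ∀ w : Fin 0 → α, letterCount w = 0 := fun w => by ext; simp [letterCount]
      simp [this, qFactorial_zero, majorIndex]
  | succ n ih =>
    by_cases hi : k i = 0
    · simp [majorGenFun_eq_zero hi, hi, qNat_zero]
    · obtain ⟨k, rfl⟩ : ∃ k' : α → ℕ, k = k' + Pi.single i 1 :=
        exists_eq_add_single hi
      have hk' : ∑ j, k j = n + 1 := by simpa [Finset.sum_add_distrib] using hk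
      have key := sum_ite_X_pow_mul_qNat k i
      rw [hk'] at key
      rw [majorGenFun_succ, prod_qFactorial_add_single, sum_filter_lt_add_single, qFactorial_succ,
        Pi.add_apply, Pi.single_eq_same, mul_left_comm, Finset.sum_mul]
      simp only [mul_assoc, ih k hk']
      simp only [← mul_assoc] at key ⊢
      rw [← Finset.sum_mul, key]
      ring

/-- MacMahon: the major index on words of a fixed content is distributed as the Gaussian
multinomial. -/
theorem sum_X_pow_majorIndex (n : ℕ) (k : α → ℕ) (hk : ∑ j, k j = n + 1) :
    ∑ w : Fin (n + 1) → α with letterCount w = k, X ^ majorIndex w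
      = qFactorial (n + 1) /ₘ ∏ j, qFactorial (k j) := by
  have hsum : ∑ i, majorGenFun n k i
      = ∑ w : Fin (n + 1) → α with letterCount w = k, X ^ majorIndex w := by
    simp only [majorGenFun]
    rw [Finset.sum_comm, Finset.sum_filter]
    refine Finset.sum_congr rfl fun w _ => ?_
    by_cases h : letterCount w = k <;> simp [h]
  have hmul : (∏ j, qFactorial (k j)) * ∑ i, majorGenFun n k i = qFactorial (n + 1) := by
    rw [mul_comm, Finset.sum_mul, Finset.sum_congr rfl fun i _ => majorGenFun_mul_prod n k hk i,
      ← Finset.sum_mul, sum_X_pow_mul_qNat univ k, hk, qFactorial_succ, mul_comm]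
  rw [← hsum, ← hmul,
    mul_divByMonic_cancel_left _ (monic_prod_of_monic _ _ fun j _ => monic_qFactorial (k j))]

end MacMahon

lemma X_pow_modByMonic_X_pow_sub_one {m : ℕ} (hm : m ≠ 0) (a : ℕ) :
    (X ^ a %ₘ (X ^ m - 1) : ℤ[X]) = X ^ (a % m) := by
  have hmonic : (X ^ m - 1 : ℤ[X]).Monic := monic_X_pow_sub_C 1 hm
  have hdvd : (X ^ m - 1 : ℤ[X]) ∣ X ^ a - X ^ (a % m) := by
    have h : (X : ℤ[X]) ^ a - X ^ (a % m) = X ^ (a % m) * ((X ^ m) ^ (a / m) - 1) := by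
      rw [mul_sub, mul_one, ← pow_mul, ← pow_add, Nat.mod_add_div]
    rw [h]
    exact (sub_one_dvd_pow_sub_one _ _).mul_left _
  rw [modByMonic_eq_of_dvd_sub hmonic hdvd, modByMonic_eq_self_iff hmonic, degree_X_pow]
  have hdeg : (X ^ m - 1 : ℤ[X]).degree = m := degree_X_pow_sub_C (Nat.pos_of_ne_zero hm) 1
  rw [hdeg]
  exact_mod_cast Nat.mod_lt a (Nat.pos_of_ne_zero hm)

lemma majorIndex_eq_sum_val {ℓ n : ℕ} (w : Fin (n + 1) → ZMod (ℓ + 1)) :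
    majorIndex (α := Fin (ℓ + 1)) w
      = ∑ r : Fin n, if (w r.succ).val < (w r.castSucc).val then (r : ℕ) + 1 else 0 :=
  rfl

lemma content_eq_letterCount {ℓ n : ℕ} (w : Fin n → ZMod (ℓ + 1)) (j : ZMod (ℓ + 1)) :
    content w j = letterCount (α := Fin (ℓ + 1)) w j := by
  unfold content letterCount
  congr!

lemma Nfun_modEq {ℓ n : ℕ} (w : Fin (n + 1) → ZMod (ℓ + 1)) :
    (Nfun w : ℤ) ≡ -(majorIndex (α := Fin (ℓ + 1)) w : ℤ) [ZMOD ((n + 1 : ℕ) : ℤ)] := by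
  classical
  have hcard : ∀ r : Fin (n + 1), (#{p : Fin (n + 1) | r < p} : ℤ)
      = (n + 1 : ℕ) - ((r : ℕ) + 1) := by
    intro r
    rw [Finset.filter_lt_eq_Ioi, Fin.card_Ioi]
    omega
  have hN : (Nfun w : ℤ) = (n + 1 : ℕ) + ∑ r ∈ desc w, (((n + 1 : ℕ) : ℤ) - ((r : ℕ) + 1)) := by
    rw [Nfun, Finset.sum_add_distrib]
    simp only [Finset.card_filter]
    rw [Finset.sum_comm]
    simp only [← Finset.card_filter]
    push_cast
    congr 1
    · simp
    · refine Finset.sum_congr rfl fun r _ => ?_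
      simpa using hcard r
  have hM : (majorIndex (α := Fin (ℓ + 1)) w : ℤ) = ∑ r ∈ desc w, (((r : ℕ) : ℤ) + 1) := by
    rw [desc, Finset.sum_filter, Fin.sum_univ_castSucc, majorIndex_eq_sum_val]
    push_cast
    simp only [Nat.add_lt_add_iff_right, lt_irrefl, IsEmpty.exists_iff, if_false, add_zero]
    refine Finset.sum_congr rfl fun r _ => ?_
    congr 1
    exact propext ⟨fun h => ⟨by simp, h⟩, fun ⟨_, h⟩ => h⟩
  rw [hN, hM, Finset.sum_sub_distrib]
  refine (Int.modEq_iff_dvd.2 ⟨-(1 + #(desc w) : ℤ), ?_⟩)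
  simp
  ring

/-- for a content `(k_0,…,k_ℓ)` with `k_0 + ⋯ + k_ℓ = m` and
`0 ≤ n < m`, the number of words `w` of length `m` with content `(k_j)` and
`N(w) ≡ −n (mod m)` equals the coefficient of `q^n` in the remainder of the
Gaussian multinomial `[m; k_0,…,k_ℓ]_q` upon division by `q^m − 1` in `ℤ[q]`. -/
theorem stmt_3 (ℓ m : ℕ) (hℓ : 1 ≤ ℓ) (hm : 1 ≤ m)
    (k : ZMod (ℓ + 1) → ℕ) (hk : ∑ j, k j = m)
    (n : ℕ) (hn : n < m) :
    ({w : Fin m → ZMod (ℓ + 1) |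
        (∀ j, content w j = k j) ∧ (Nfun w : ℤ) ≡ -(n : ℤ) [ZMOD (m : ℤ)]}.ncard : ℤ)
      = (qMultinomial m k %ₘ (X ^ m - 1 : Polynomial ℤ)).coeff n := by
  classical
  obtain ⟨m, rfl⟩ : ∃ m', m = m' + 1 := ⟨m - 1, by omega⟩
  have hmac := sum_X_pow_majorIndex (α := Fin (ℓ + 1)) m k hk
  rw [qMultinomial, if_pos hk]
  refine Eq.trans ?_ (congrArg (fun p : ℤ[X] => (p %ₘ (X ^ (m + 1) - 1)).coeff n) hmac)
  have hset : @Eq (Set (Fin (m + 1) → Fin (ℓ + 1)))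
      {w : Fin (m + 1) → ZMod (ℓ + 1) | (∀ j, content w j = k j) ∧
        (Nfun w : ℤ) ≡ -(n : ℤ) [ZMOD ((m + 1 : ℕ) : ℤ)]}
      (({w | letterCount w = k ∧ majorIndex w % (m + 1) = n} :
        Finset (Fin (m + 1) → Fin (ℓ + 1))) : Set (Fin (m + 1) → Fin (ℓ + 1))) := by
    ext w
    rw [Finset.mem_coe, Finset.mem_filter_univ]
    refine and_congr ?_ ?_
    · exact (forall_congr' fun j => Eq.congr (content_eq_letterCount w j) rfl).trans
        funext_iff.symm
    · have h := Nfun_modEq w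
      have hiff : (Nfun w : ℤ) ≡ -(n : ℤ) [ZMOD ((m + 1 : ℕ) : ℤ)] ↔
          (majorIndex (α := Fin (ℓ + 1)) w : ℤ) ≡ n [ZMOD ((m + 1 : ℕ) : ℤ)] :=
        ⟨fun h' => by simpa using (h.symm.trans h').neg, fun h' => h.trans h'.neg⟩
      rw [hiff, Int.natCast_modEq_iff, Nat.ModEq, Nat.mod_eq_of_lt hn]
  have hcoe := congrArg Set.ncard hset
  refine (congrArg Nat.cast (hcoe.trans (Set.ncard_coe_finset _))).trans ?_
  have hlin : ∀ p : ℤ[X], p %ₘ (X ^ (m + 1) - 1) = modByMonicHom (X ^ (m + 1) - 1) p :=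
    fun _ => rfl
  rw [hlin, map_sum]
  simp only [← hlin, X_pow_modByMonic_X_pow_sub_one m.add_one_ne_zero, finsetSum_coeff, coeff_X_pow]
  rw [Finset.sum_boole, Finset.filter_filter]
  simp only [eq_comm]
  congr!

end GreensteinPaths
end
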